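/- arXiv:1402.3447 — 12 statements merged into one kernel-verified Lean document; each statement's English description precedes it below -/
import Mathlib

section
/- Let Γ be a nonnegative integrable random variable with E[Γ] > 0, let v : [0,1] → ℝ be a concave, non-decreasing, non-negative function, let z ∈ [0,1] and μ > 0, and set y = μ·z·E[Γ]. Then the expected value obtained by bidding y against the others' total bid Γ satisfies E[v(y/(y+Γ))] ≥ ((3μ−1)/(4μ))·v(z); consequently the expected utility E[v(y/(y+Γ))] − y is at least ((3μ−1)/(4μ))·v(z) − μ·z·E[Γ]. -/
open MeasureTheory

/-- A concave function that is non-negative at `0` satisfies `l * v z ≤ v (l * z)`. -/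
theorem ConcaveOn.mul_le_apply_mul {s : Set ℝ} {v : ℝ → ℝ} (hconc : ConcaveOn ℝ s v)
    (h0 : 0 ∈ s) (hv0 : 0 ≤ v 0) {z l : ℝ} (hz : z ∈ s) (hl0 : 0 ≤ l) (hl1 : l ≤ 1) :
    l * v z ≤ v (l * z) := by
  have h := hconc.2 hz h0 hl0 (sub_nonneg.2 hl1) (by ring)
  simp only [smul_eq_mul, mul_zero, add_zero] at h
  nlinarith [mul_nonneg (sub_nonneg.2 hl1) hv0]

/-- The tangent line to `g ↦ a / (a + g)` at `g = a` lies below the graph. -/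
theorem three_quarters_sub_le_div_add {a g : ℝ} (ha : 0 < a) (hg : 0 ≤ g) :
    3 / 4 - g / (4 * a) ≤ a / (a + g) := by
  have key : a / (a + g) - (3 / 4 - g / (4 * a)) = (a - g) ^ 2 / (4 * a * (a + g)) := by
    field_simp
    ring
  have : 0 ≤ (a - g) ^ 2 / (4 * a * (a + g)) := by positivity
  linarith

/-- Bidding `a * z` against a total bid `g` yields value at least `(3 / 4 - g / (4 * a)) * v z`. -/
theorem ConcaveOn.le_apply_proportional_share {v : ℝ → ℝ}
    (hconc : ConcaveOn ℝ (Set.Icc 0 1) v) (hmono : MonotoneOn v (Set.Icc 0 1))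
    (hnonneg : ∀ t ∈ Set.Icc (0 : ℝ) 1, 0 ≤ v t) {z a g : ℝ} (hz : z ∈ Set.Icc (0 : ℝ) 1)
    (ha : 0 < a) (hg : 0 ≤ g) :
    (3 / 4 - g / (4 * a)) * v z ≤ v (a * z / (a * z + g)) := by
  obtain ⟨hz0, hz1⟩ := hz
  have haz : 0 ≤ a * z := by positivity
  have hl0 : 0 ≤ a / (a + g) := by positivity
  have hl1 : a / (a + g) ≤ 1 := div_le_one_of_le₀ (by linarith) (by positivity)
  have hle : a / (a + g) * z ≤ a * z / (a * z + g) := by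
    rcases hz0.eq_or_lt with rfl | hzpos
    · simp
    · rw [div_mul_eq_mul_div]
      exact div_le_div_of_nonneg_left haz (by positivity) (by nlinarith)
  calc (3 / 4 - g / (4 * a)) * v z
      ≤ a / (a + g) * v z := mul_le_mul_of_nonneg_right
        (three_quarters_sub_le_div_add ha hg) (hnonneg z ⟨hz0, hz1⟩)
    _ ≤ v (a / (a + g) * z) := hconc.mul_le_apply_mul (by simp) (hnonneg 0 (by simp))
        ⟨hz0, hz1⟩ hl0 hl1
    _ ≤ v (a * z / (a * z + g)) := hmono ⟨by positivity, mul_le_one₀ hl1 hz0 hz1⟩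
        ⟨by positivity, div_le_one_of_le₀ (by linarith) (by positivity)⟩ hle

/-- **Deviation lemma** (Lemma 1 of the paper). If a bidder with concave, non-decreasing,
non-negative valuation `v` deviates to the deterministic bid `y = μ·z·E[Γ]`, where `Γ` is the
(random) sum of the other bidders' bids, then her expected value is at least
`((3μ-1)/(4μ))·v z`, and hence her expected utility at least `((3μ-1)/(4μ))·v z - μ·z·E[Γ]`. -/
theorem stmt_0
    {Ω : Type*} [MeasurableSpace Ω] (P : Measure Ω) [IsProbabilityMeasure P]
    (Γ : Ω → ℝ) (hΓmeas : Measurable Γ) (hΓnonneg : ∀ ω, 0 ≤ Γ ω)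
    (hΓint : Integrable Γ P) (hΓpos : 0 < ∫ ω, Γ ω ∂P)
    (v : ℝ → ℝ) (hconc : ConcaveOn ℝ (Set.Icc 0 1) v)
    (hmono : MonotoneOn v (Set.Icc 0 1))
    (hnonneg : ∀ t ∈ Set.Icc (0:ℝ) 1, 0 ≤ v t)
    (z : ℝ) (hz : z ∈ Set.Icc (0:ℝ) 1) (μ : ℝ) (hμ : 0 < μ)
    (y : ℝ) (hy : y = μ * z * ∫ ω, Γ ω ∂P)
    (hint : Integrable (fun ω => v (y / (y + Γ ω))) P) :
    (∫ ω, v (y / (y + Γ ω)) ∂P) ≥ (3 * μ - 1) / (4 * μ) * v z ∧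
    (∫ ω, v (y / (y + Γ ω)) ∂P) - y ≥
      (3 * μ - 1) / (4 * μ) * v z - μ * z * ∫ ω, Γ ω ∂P := by
  have ha : 0 < μ * ∫ ω, Γ ω ∂P := mul_pos hμ hΓpos
  have hvalue : (3 * μ - 1) / (4 * μ) * v z ≤ ∫ ω, v (y / (y + Γ ω)) ∂P := by
    have hlin : Integrable (fun ω => 3 / 4 - Γ ω / (4 * (μ * ∫ ω, Γ ω ∂P))) P :=
      (integrable_const _).sub (hΓint.div_const _)
    calc (3 * μ - 1) / (4 * μ) * v z
        = ∫ ω, (3 / 4 - Γ ω / (4 * (μ * ∫ ω, Γ ω ∂P))) * v z ∂P := by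
          rw [integral_mul_const, integral_sub (integrable_const _) (hΓint.div_const _),
            integral_const, integral_div, probReal_univ, one_smul]
          congr 1
          field_simp
      _ ≤ ∫ ω, v (y / (y + Γ ω)) ∂P := by
          refine integral_mono (hlin.mul_const _) hint fun ω => ?_
          have hya : y = (μ * ∫ ω, Γ ω ∂P) * z := by rw [hy]; ring
          simpa only [hya] using
            hconc.le_apply_proportional_share hmono hnonneg hz ha (hΓnonneg ω)
  exact ⟨hvalue, by rw [← hy]; exact sub_le_sub_right hvalue y⟩
end

section
/- Let Γ be a nonnegative integrable random variable on a probability space, let y > 0, and let T be a measurable event. Then E[(y/(y+Γ))·1_T] ≥ y·P[T]² / (y·P[T] + E[Γ]), and consequently E[(y/(y+Γ))·1_T] ≥ y·P[T]² / (y + E[Γ]). -/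
open MeasureTheory

/-- The tangent line inequality `1 / s ≥ 2 c - c² s`, scaled by `y` and taken at `s = y + t`. -/
lemma tangent_le_div_add {y t : ℝ} (hy : 0 < y) (ht : 0 ≤ t) (c : ℝ) :
    2 * c * y - c ^ 2 * y ^ 2 - c ^ 2 * y * t ≤ y / (y + t) := by
  rw [le_div_iff₀ (by positivity)]
  nlinarith [mul_nonneg hy.le (sq_nonneg (c * (y + t) - 1))]

/-- If `Γ` is a nonnegative integrable random variable, `y > 0` and `T` is a measurable event,
then `E[(y/(y+Γ))·1_T] ≥ y·P[T]² / (y·P[T] + E[Γ])`, and consequently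
`E[(y/(y+Γ))·1_T] ≥ y·P[T]² / (y + E[Γ])`. -/
theorem stmt_1
    {Ω : Type*} [MeasurableSpace Ω] (P : Measure Ω) [IsProbabilityMeasure P]
    (Γ : Ω → ℝ) (hΓmeas : Measurable Γ) (hΓnonneg : ∀ ω, 0 ≤ Γ ω)
    (hΓint : Integrable Γ P)
    (y : ℝ) (hy : 0 < y) (T : Set Ω) (hT : MeasurableSet T) :
    (∫ ω, T.indicator (fun ω => y / (y + Γ ω)) ω ∂P) ≥
      y * (P T).toReal ^ 2 / (y * (P T).toReal + ∫ ω, Γ ω ∂P) ∧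
    (∫ ω, T.indicator (fun ω => y / (y + Γ ω)) ω ∂P) ≥
      y * (P T).toReal ^ 2 / (y + ∫ ω, Γ ω ∂P) := by
  set p := (P T).toReal with hp
  set E := ∫ ω, Γ ω ∂P
  have hp0 : 0 ≤ p := ENNReal.toReal_nonneg
  have hp1 : p ≤ 1 := measureReal_le_one
  have hE0 : 0 ≤ E := integral_nonneg hΓnonneg
  have hfint : Integrable (T.indicator fun ω => y / (y + Γ ω)) P := by
    refine Integrable.of_bound
      ((measurable_const.div (measurable_const.add hΓmeas)).indicator hT).aestronglyMeasurable 1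
      (Filter.Eventually.of_forall fun ω => (norm_indicator_le_norm_self _ _).trans ?_)
    have hΓω := hΓnonneg ω
    rw [Real.norm_of_nonneg (by positivity)]
    exact div_le_one_of_le₀ (by linarith) (by positivity)
  have key (c : ℝ) : (2 * c * y - c ^ 2 * y ^ 2) * p - c ^ 2 * y * E ≤
      ∫ ω, T.indicator (fun ω => y / (y + Γ ω)) ω ∂P := by
    have hconst : Integrable (T.indicator fun _ => 2 * c * y - c ^ 2 * y ^ 2) P :=
      (integrable_const _).indicator hT
    have hlin : Integrable (fun ω => c ^ 2 * y * Γ ω) P := hΓint.const_mul _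
    calc (2 * c * y - c ^ 2 * y ^ 2) * p - c ^ 2 * y * E
        = ∫ ω, (T.indicator (fun _ => 2 * c * y - c ^ 2 * y ^ 2) ω - c ^ 2 * y * Γ ω) ∂P := by
          rw [integral_sub hconst hlin, integral_indicator_const _ hT, integral_const_mul,
            smul_eq_mul, mul_comm, hp, measureReal_def]
      _ ≤ _ := by
          refine integral_mono (hconst.sub hlin) hfint fun ω => ?_
          have hΓω := hΓnonneg ω
          by_cases hω : ω ∈ T
          · simpa [hω] using tangent_le_div_add hy hΓω c
          · simpa [hω] using (by positivity : 0 ≤ c ^ 2 * y * Γ ω)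
  have first : y * p ^ 2 / (y * p + E) ≤
      ∫ ω, T.indicator (fun ω => y / (y + Γ ω)) ω ∂P := by
    rcases (by positivity : 0 ≤ y * p + E).eq_or_lt with hD | hD
    · simpa [← hD] using key 0
    · refine le_of_eq_of_le ?_ (key (p / (y * p + E)))
      field_simp
      ring
  refine ⟨first, le_trans ?_ first⟩
  rcases hp0.eq_or_lt with h0 | h0
  · simp [← h0]
  · gcongr
    exact mul_le_of_le_one_right hy.le hp1
end

section
/- Consider n bidders where bidder i has a concave, non-decreasing, non-negative valuation function v_i : [0,1] → ℝ. Let b = (b_1,…,b_n) be a (possibly correlated) random vector of nonnegative, integrable bids, let B = Σ_j b_j, B_{−i} = Σ_{j≠i} b_j, and let d_i = b_i / B be the share of bidder i (with the convention that a fraction with zero denominator equals 0). Suppose b is a coarse-correlated equilibrium: for every bidder i and every deterministic bid y ≥ 0, E[v_i(d_i) − b_i] ≥ E[v_i(y/(y+B_{−i}))] − y. Then for every allocation (x_1,…,x_n) with x_i ≥ 0 and Σ_i x_i ≤ 1, the expected social welfare satisfies E[Σ_i v_i(d_i)] ≥ (1/2)·Σ_i v_i(x_i). In particular, the price of anarchy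 of proportional allocation games over coarse-correlated equilibria is at least 1/2. -/
open MeasureTheory

/-- A concave, nonnegative function shrinks at most proportionally when its argument shrinks. -/
theorem ConcaveOn.mul_le_apply_mul_s2 {f : ℝ → ℝ} (hf : ConcaveOn ℝ (Set.Icc 0 1) f)
    (h0 : 0 ≤ f 0) {c x : ℝ} (hc0 : 0 ≤ c) (hc1 : c ≤ 1) (hx : x ∈ Set.Icc (0 : ℝ) 1) :
    c * f x ≤ f (c * x) := by
  have h := hf.2 hx (show (0 : ℝ) ∈ Set.Icc 0 1 by simp) hc0 (sub_nonneg.2 hc1) (by ring)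
  simp only [smul_eq_mul, mul_zero, add_zero] at h
  nlinarith [mul_nonneg (sub_nonneg.2 hc1) h0]

/-- The value of bidding `x * m` against total competing bid `t`, bounded below by an affine
function of `t`. -/
theorem affine_le_value_of_scaled_bid {f : ℝ → ℝ} (hconc : ConcaveOn ℝ (Set.Icc 0 1) f)
    (hmono : MonotoneOn f (Set.Icc 0 1)) (hnonneg : ∀ t ∈ Set.Icc (0 : ℝ) 1, 0 ≤ f t)
    {x m t : ℝ} (hx : x ∈ Set.Icc (0 : ℝ) 1) (hm : 0 < m) (ht : 0 ≤ t) :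
    (3 / 4 - t / (4 * m)) * f x ≤ f (x * m / (x * m + t)) := by
  have hx0 := hx.1
  have hx1 := hx.2
  have hmt : 0 < m + t := by positivity
  have hc0 : 0 ≤ m / (m + t) := by positivity
  have hc1 : m / (m + t) ≤ 1 := div_le_one_of_le₀ (by linarith) hmt.le
  have hxm : 0 ≤ x * m := by positivity
  have htangent : 3 / 4 - t / (4 * m) ≤ m / (m + t) := by
    rw [le_div_iff₀ hmt, ← sub_nonneg]
    have : m - (3 / 4 - t / (4 * m)) * (m + t) = (m - t) ^ 2 / (4 * m) := by
      field_simp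
      ring
    rw [this]
    positivity
  have hshare : m / (m + t) * x ≤ x * m / (x * m + t) := by
    rcases hx0.eq_or_lt with rfl | hpos
    · simp
    · rw [div_mul_eq_mul_div, mul_comm m x]
      exact div_le_div_of_nonneg_left hxm (by positivity) (by nlinarith)
  calc (3 / 4 - t / (4 * m)) * f x ≤ m / (m + t) * f x :=
        mul_le_mul_of_nonneg_right htangent (hnonneg x hx)
    _ ≤ f (m / (m + t) * x) := hconc.mul_le_apply_mul_s2 (hnonneg 0 (by simp)) hc0 hc1 hx
    _ ≤ f (x * m / (x * m + t)) :=
        hmono ⟨by positivity, mul_le_one₀ hc1 hx0 hx1⟩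
          ⟨by positivity, div_le_one_of_le₀ (by linarith) (by linarith)⟩ hshare

/-- **Price of anarchy over coarse-correlated equilibria.** At any coarse-correlated equilibrium
of a proportional allocation game, the expected social welfare is at least half of the welfare
of any feasible allocation; in particular the price of anarchy is at least 1/2. -/
theorem stmt_2
    {Ω : Type*} [MeasurableSpace Ω] (P : Measure Ω) [IsProbabilityMeasure P]
    (n : ℕ) (v : Fin n → ℝ → ℝ)
    (hconc : ∀ i, ConcaveOn ℝ (Set.Icc 0 1) (v i))
    (hmono : ∀ i, MonotoneOn (v i) (Set.Icc 0 1))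
    (hnonneg : ∀ i, ∀ t ∈ Set.Icc (0:ℝ) 1, 0 ≤ v i t)
    (b : Fin n → Ω → ℝ)
    (hbmeas : ∀ i, Measurable (b i))
    (hbnonneg : ∀ i ω, 0 ≤ b i ω)
    (hbint : ∀ i, Integrable (b i) P)
    (hdint : ∀ i, Integrable (fun ω => v i (b i ω / ∑ j, b j ω)) P)
    (hdevint : ∀ i (y : ℝ),
      Integrable (fun ω => v i (y / (y + ∑ j ∈ Finset.univ.erase i, b j ω))) P)
    (heq : ∀ i, ∀ y : ℝ, 0 ≤ y →
      (∫ ω, (v i (b i ω / ∑ j, b j ω) - b i ω) ∂P) ≥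
        (∫ ω, v i (y / (y + ∑ j ∈ Finset.univ.erase i, b j ω)) ∂P) - y)
    (x : Fin n → ℝ) (hx : ∀ i, 0 ≤ x i) (hxsum : ∑ i, x i ≤ 1) :
    (∫ ω, ∑ i, v i (b i ω / ∑ j, b j ω) ∂P) ≥ (1 / 2) * ∑ i, v i (x i) := by
  have hx1 : ∀ i, x i ∈ Set.Icc (0 : ℝ) 1 := fun i =>
    ⟨hx i, (Finset.single_le_sum (fun j _ => hx j) (Finset.mem_univ i)).trans hxsum⟩
  set μ : ℝ := ∑ j, ∫ ω, b j ω ∂P with hμ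
  have hb0 : ∀ i, 0 ≤ ∫ ω, b i ω ∂P := fun i => integral_nonneg (hbnonneg i)
  have hμ0 : 0 ≤ μ := Finset.sum_nonneg fun i _ => hb0 i
  have hdeviation : ∀ m, 0 < m → μ ≤ m → ∀ i,
      1 / 2 * v i (x i) - x i * m ≤
        (∫ ω, v i (b i ω / ∑ j, b j ω) ∂P) - ∫ ω, b i ω ∂P := by
    intro m hm hle i
    have hTint : Integrable (fun ω => ∑ j ∈ Finset.univ.erase i, b j ω) P :=
      integrable_finsetSum _ fun j _ => hbint j
    have hT : (∫ ω, ∑ j ∈ Finset.univ.erase i, b j ω ∂P) ≤ m := by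
      rw [integral_finsetSum _ fun j _ => hbint j]
      exact (Finset.sum_le_sum_of_subset_of_nonneg (Finset.erase_subset _ _)
        fun j _ _ => hb0 j).trans hle
    have hlower := integral_mono
      (((integrable_const (3 / 4 : ℝ)).sub (hTint.div_const (4 * m))).mul_const (v i (x i)))
      (hdevint i (x i * m)) fun ω =>
        affine_le_value_of_scaled_bid (hconc i) (hmono i) (hnonneg i) (hx1 i) hm
          (Finset.sum_nonneg fun j (_ : j ∈ Finset.univ.erase i) => hbnonneg j ω)
    simp only [Pi.sub_apply] at hlower
    rw [integral_mul_const, integral_sub (integrable_const _) (hTint.div_const _),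
      integral_const, integral_div] at hlower
    simp only [probReal_univ, one_smul] at hlower
    have hquarter : (∫ ω, ∑ j ∈ Finset.univ.erase i, b j ω ∂P) / (4 * m) ≤ 1 / 4 := by
      rw [div_le_iff₀ (by positivity)]
      linarith
    have hhalf := mul_le_mul_of_nonneg_right
      (show 1 / 2 ≤ 3 / 4 - (∫ ω, ∑ j ∈ Finset.univ.erase i, b j ω ∂P) / (4 * m) by linarith)
      (hnonneg i _ (hx1 i))
    have h := heq i (x i * m) (mul_nonneg (hx i) hm.le)
    rw [integral_sub (hdint i) (hbint i)] at h
    linarith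
  rw [integral_finsetSum _ fun i _ => hdint i, ge_iff_le]
  refine le_of_forall_pos_le_add fun ε hε => ?_
  have hsum := Finset.sum_le_sum fun i (_ : i ∈ Finset.univ) =>
    hdeviation (μ + ε) (by linarith) (by linarith) i
  rw [Finset.sum_sub_distrib, Finset.sum_sub_distrib, ← Finset.mul_sum, ← Finset.sum_mul,
    ← hμ] at hsum
  have := mul_le_mul_of_nonneg_right hxsum (show 0 ≤ μ + ε by linarith)
  linarith
end

section
/- For every ε > 0, there exists a proportional allocation game with the following property. The game has n ≥ 2 bidders with v_1(t) = t and v_i(t) = ((n−1)/(2n−3))·t for i ≥ 2; the bid vector b with b_1 = 1/4 and b_i = 1/(4(n−1)) for i ≥ 2 is a pure Nash equilibrium; the optimal allocation is x_1 = 1, x_i = 0 for i ≥ 2, with optimal social welfare SW* = 1; and every pair of reals λ, μ satisfying Σ_i u_i(b) ≥ λ·SW* − μ·Σ_i x_i·B_{−i} (where B_{−i} = Σ_{j≠i} b_j) must satisfy λ ≤ max{1, μ}·(1/2 + ε). -/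
open Finset

/-- With competing bids summing to `B` and slope `a = 1 / (4 * B)`, the bid `1 / 2 - B` is a best
response. -/
lemma linear_best_response {a B y : ℝ} (hB : 0 < B) (hy : 0 ≤ y) (h : a * B = 1 / 4) :
    a * (y / (y + B)) - y ≤ a * ((1 / 2 - B) / (1 / 2)) - (1 / 2 - B) := by
  have hz : 0 < y + B := by linarith
  have key : a * (y / (y + B)) = a - 1 / 4 / (y + B) := by
    rw [← h]
    field_simp
    ring
  have amgm : 1 - (y + B) ≤ 1 / 4 / (y + B) := by
    rw [le_div_iff₀ hz]
    nlinarith [sq_nonneg (y + B - 1 / 2)]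
  linear_combination amgm + key + 2 * h

/-- **Tightness of the smoothness-style analysis.** For every `ε > 0` there is a proportional
allocation game (with `n ≥ 2` bidders, linear valuations as described, explicit pure Nash
equilibrium bids `b`, and optimal allocation `x` with `SW* = 1`) such that any reals `λ, μ`
satisfying `∑ᵢ uᵢ(b) ≥ λ·SW* − μ·∑ᵢ xᵢ·B₋ᵢ` must satisfy `λ ≤ max{1,μ}·(1/2 + ε)`. -/
theorem stmt_3 :
    ∀ ε : ℝ, 0 < ε → ∃ n : ℕ, 2 ≤ n ∧
      ∀ (v : Fin n → ℝ → ℝ) (b x : Fin n → ℝ),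
        (v = fun (i : Fin n) (t : ℝ) => if i.val = 0 then t else ((n : ℝ) - 1) / (2 * (n : ℝ) - 3) * t) →
        (b = fun (i : Fin n) => if i.val = 0 then 1 / 4 else 1 / (4 * ((n : ℝ) - 1))) →
        (x = fun (i : Fin n) => if i.val = 0 then (1:ℝ) else 0) →
        -- b is a pure Nash equilibrium
        ((∀ i, ∀ y : ℝ, 0 ≤ y →
            v i (b i / ∑ j, b j) - b i ≥
              v i (y / (y + ∑ j ∈ Finset.univ.erase i, b j)) - y) ∧
        -- x is the optimal allocation, with optimal social welfare SW* = 1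
        (∀ i, 0 ≤ x i) ∧ (∑ i, x i ≤ 1) ∧ (∑ i, v i (x i) = 1) ∧
        (∀ x' : Fin n → ℝ, (∀ i, 0 ≤ x' i) → ∑ i, x' i ≤ 1 → ∑ i, v i (x' i) ≤ 1) ∧
        -- any (λ, μ) satisfying the smoothness-type inequality has λ ≤ max{1,μ}·(1/2+ε)
        (∀ lam mu : ℝ,
          (∑ i, (v i (b i / ∑ j, b j) - b i) ≥
            lam * 1 - mu * ∑ i, x i * ∑ j ∈ Finset.univ.erase i, b j) →
          lam ≤ max 1 mu * (1 / 2 + ε))) := by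
  intro ε hε
  obtain ⟨m, hm⟩ := exists_nat_gt (1 / ε)
  have hm0 : (0 : ℝ) ≤ m := m.cast_nonneg
  have hmε : 1 < m * ε := by rwa [div_lt_iff₀ hε] at hm
  refine ⟨m + 2, by omega, ?_⟩
  rintro v b x hv hb hx
  have hn1 : ((m + 2 : ℕ) : ℝ) - 1 = m + 1 := by push_cast; ring
  have hn2 : 2 * ((m + 2 : ℕ) : ℝ) - 3 = 2 * m + 1 := by push_cast; ring
  simp only [hn1, hn2] at hv hb
  have h1 : (0 : ℝ) < m + 1 := by linarith
  have h2 : (0 : ℝ) < 2 * m + 1 := by linarith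
  have hv0 (t : ℝ) : v 0 t = t := by simp [hv]
  have hvs (i : Fin (m + 1)) (t : ℝ) : v i.succ t = (m + 1) / (2 * m + 1) * t := by simp [hv]
  have hb0 : b 0 = 1 / 4 := by simp [hb]
  have hbs (i : Fin (m + 1)) : b i.succ = 1 / (4 * (m + 1)) := by simp [hb]
  have hx0 : x 0 = 1 := by simp [hx]
  have hxs (i : Fin (m + 1)) : x i.succ = 0 := by simp [hx]
  have hsum : ∑ j, b j = 1 / 2 := by
    rw [Fin.sum_univ_succ]
    simp only [hb0, hbs, sum_const, card_univ, Fintype.card_fin, nsmul_eq_mul]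
    push_cast
    field_simp
    norm_num
  have herase (i : Fin (m + 2)) : ∑ j ∈ univ.erase i, b j = 1 / 2 - b i := by
    rw [← hsum, ← add_sum_erase univ b (mem_univ i)]
    ring
  have hslope : ((m : ℝ) + 1) / (2 * m + 1) ≤ 1 := by
    rw [div_le_one h2]
    linarith
  simp only [herase, hsum]
  refine ⟨?_, ?_, ?_, ?_, ?_, ?_⟩
  · intro i y hy
    cases i using Fin.cases with
    | zero =>
      have h := linear_best_response (a := 1) (B := 1 / 2 - 1 / 4) (by norm_num) hy (by norm_num)
      simpa only [hv0, hb0, one_mul, sub_sub_cancel] using h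
    | succ i =>
      have hB : (1 : ℝ) / 2 - 1 / (4 * (m + 1)) = (2 * m + 1) / (4 * (m + 1)) := by
        field_simp
        ring
      have h := linear_best_response (a := (m + 1) / (2 * m + 1))
        (B := 1 / 2 - 1 / (4 * (m + 1))) (by rw [hB]; positivity) hy
        (by rw [hB]; field_simp)
      simpa only [hvs, hbs, sub_sub_cancel] using h
  · intro i
    cases i using Fin.cases <;> simp [hx0, hxs]
  · simp [Fin.sum_univ_succ (n := m + 1), hx0, hxs]
  · simp [Fin.sum_univ_succ (n := m + 1), hx0, hxs, hv0, hvs]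
  · intro x' hx' hx'sum
    refine le_trans (sum_le_sum fun i _ => ?_) hx'sum
    cases i using Fin.cases with
    | zero => rw [hv0]
    | succ i =>
      rw [hvs]
      exact mul_le_of_le_one_left (hx' _) hslope
  · intro lam mu h
    rw [Fin.sum_univ_succ (n := m + 1), Fin.sum_univ_succ (n := m + 1)] at h
    simp only [hv0, hvs, hb0, hbs, hx0, hxs, zero_mul, sum_const, card_univ, Fintype.card_fin,
      nsmul_eq_mul, mul_zero, add_zero] at h
    have hwelfare : (1 / 4 / (1 / 2) - 1 / 4 + ((m + 1 : ℕ) : ℝ) *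
        ((m + 1) / (2 * m + 1) * (1 / (4 * (m + 1)) / (1 / 2)) - 1 / (4 * (m + 1))))
        = 1 / 4 + 1 / (4 * (2 * m + 1)) := by
      push_cast
      field_simp
      ring
    rw [hwelfare] at h
    have hgap : 1 / (4 * (2 * (m : ℝ) + 1)) ≤ ε := by
      rw [div_le_iff₀ (by positivity)]
      nlinarith
    have hε_le : ε ≤ max 1 mu * ε := le_mul_of_one_le_left hε.le (le_max_left 1 mu)
    linarith [le_max_left 1 mu, le_max_right 1 mu]
end

section
/- Let n ≥ 2 and consider the proportional allocation game with n bidders in which v_1(t) = t and v_i(t) = ((n−1)/(2n−3))·t for i ≥ 2. Then the bid vector b with b_1 = 1/4 and b_i = 1/(4(n−1)) for i ≥ 2 is a pure Nash equilibrium: for every bidder i and every y ≥ 0, v_i(b_i/(b_i+B_{−i})) − b_i ≥ v_i(y/(y+B_{−i})) − y, where B_{−i} = Σ_{j≠i} b_j. In this equilibrium bidder 1 receives share 1/2 and each bidder i ≥ 2 receives share 1/(2(n−1)); moreover u_1(b) = 1/4 and Σ_{i≥2} u_i(b) = 1/(4(2n−3)). -/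
open Finset

/-- A bidder with linear valuation `c * t` facing a total opposing bid `B` with `c * B = 1 / 4`
does best by raising the total bid to `1 / 2`. -/
theorem linear_utility_le {c B x y : ℝ} (hB : 0 < B) (hcB : c * B = 1 / 4)
    (hx : x + B = 1 / 2) (hy : 0 ≤ y) :
    c * (y / (y + B)) - y ≤ c * (x / (x + B)) - x := by
  have hs : 0 < y + B := by linarith
  have hdiff : c * (x / (x + B)) - x - (c * (y / (y + B)) - y)
      = (y + B - 1 / 2) ^ 2 / (y + B) := by
    obtain rfl : x = 1 / 2 - B := by linarith
    rw [hx]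
    field_simp
    linear_combination (4 - 8 * (y + B)) * hcB
  have : 0 ≤ (y + B - 1 / 2) ^ 2 / (y + B) := by positivity
  linarith

/-- In the proportional allocation game with `n ≥ 2` bidders, `v₁(t) = t` and
`vᵢ(t) = ((n-1)/(2n-3))·t` for `i ≥ 2`, the bid vector with `b₁ = 1/4` and
`bᵢ = 1/(4(n-1))` for `i ≥ 2` is a pure Nash equilibrium; bidder 1 receives share `1/2`,
each bidder `i ≥ 2` receives share `1/(2(n-1))`, `u₁(b) = 1/4`, and
`∑_{i≥2} uᵢ(b) = 1/(4(2n-3))`. -/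
theorem stmt_4 (n : ℕ) (hn : 2 ≤ n)
    (v : Fin n → ℝ → ℝ)
    (hv : v = fun (i : Fin n) (t : ℝ) =>
      if i.val = 0 then t else ((n : ℝ) - 1) / (2 * (n : ℝ) - 3) * t)
    (b : Fin n → ℝ)
    (hb : b = fun (i : Fin n) => if i.val = 0 then 1 / 4 else 1 / (4 * ((n : ℝ) - 1))) :
    -- pure Nash equilibrium
    (∀ i, ∀ y : ℝ, 0 ≤ y →
      v i (b i / (b i + ∑ j ∈ Finset.univ.erase i, b j)) - b i ≥
        v i (y / (y + ∑ j ∈ Finset.univ.erase i, b j)) - y) ∧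
    -- shares
    (∀ i, b i / ∑ j, b j = if i.val = 0 then 1 / 2 else 1 / (2 * ((n : ℝ) - 1))) ∧
    -- utilities
    (∀ i, i.val = 0 → v i (b i / ∑ j, b j) - b i = 1 / 4) ∧
    (∑ i ∈ Finset.univ.filter (fun i : Fin n => i.val ≠ 0),
        (v i (b i / ∑ j, b j) - b i) = 1 / (4 * (2 * (n : ℝ) - 3))) := by
  have hn' : (2 : ℝ) ≤ n := by exact_mod_cast hn
  have h1 : (0 : ℝ) < (n : ℝ) - 1 := by linarith
  have h3 : (0 : ℝ) < 2 * (n : ℝ) - 3 := by linarith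
  have h3' : (n : ℝ) * 2 - 3 ≠ 0 := ne_of_gt (by linarith)
  have hcard : ((Finset.univ.filter (fun i : Fin n => i.val ≠ 0)).card : ℝ) = (n : ℝ) - 1 := by
    obtain ⟨m, rfl⟩ : ∃ m, n = m + 1 := ⟨n - 1, by omega⟩
    have : (Finset.univ.filter (fun i : Fin (m + 1) => i.val ≠ 0)) = Finset.univ.erase 0 := by
      ext i
      simp only [Finset.mem_filter, Finset.mem_univ, true_and, Finset.mem_erase, and_true, ne_eq,
        Fin.ext_iff, Fin.val_zero]
    rw [this, Finset.card_erase_of_mem (Finset.mem_univ _)]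
    simp
  have hsum : ∑ j, b j = 1 / 2 := by
    obtain ⟨m, rfl⟩ : ∃ m, n = m + 1 := ⟨n - 1, by omega⟩
    rw [Fin.sum_univ_succ]
    have hm : (m : ℝ) ≠ 0 := by
      rintro h
      simp [h] at h1
    simp only [hb, Fin.val_zero, Fin.val_succ, if_true, Nat.add_one_ne_zero, if_false,
      Finset.sum_const, Finset.card_univ, Fintype.card_fin, nsmul_eq_mul]
    push_cast
    rw [add_sub_cancel_right]
    field_simp
    norm_num
  have hadd : ∀ i, b i + ∑ j ∈ Finset.univ.erase i, b j = 1 / 2 := fun i => by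
    rw [Finset.add_sum_erase _ _ (Finset.mem_univ i), hsum]
  have hshare : ∀ i, b i / ∑ j, b j =
      if i.val = 0 then 1 / 2 else 1 / (2 * ((n : ℝ) - 1)) := by
    intro i
    rw [hsum, hb]
    by_cases hi : i.val = 0
    · simp only [hi, if_true]
      norm_num
    · simp only [hi, if_false]
      field_simp
      norm_num
  refine ⟨?_, hshare, ?_, ?_⟩
  · intro i y hy
    have hi' := hadd i
    generalize ∑ j ∈ Finset.univ.erase i, b j = B at hi' ⊢
    by_cases hi : i.val = 0
    · have hbi : b i = 1 / 4 := by simp [hb, hi]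
      have hB : B = 1 / 4 := by linarith
      have := linear_utility_le (c := 1) (by linarith) (by linarith) hi' hy
      simpa [hv, hi] using this
    · have hbi : b i = 1 / (4 * ((n : ℝ) - 1)) := by simp [hb, hi]
      have hB : B = (2 * (n : ℝ) - 3) / (4 * ((n : ℝ) - 1)) := by
        have : B = 1 / 2 - 1 / (4 * ((n : ℝ) - 1)) := by linarith
        rw [this]
        field_simp
        ring
      have hcB : ((n : ℝ) - 1) / (2 * (n : ℝ) - 3) * B = 1 / 4 := by
        rw [hB]
        field_simp
      have := linear_utility_le (by rw [hB]; positivity) hcB hi' hy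
      simpa only [hv, hi, if_false, ge_iff_le] using this
  · intro i hi
    rw [hshare i]
    simp only [hv, hb, hi, if_true]
    norm_num
  · have hterm : ∀ i ∈ Finset.univ.filter (fun i : Fin n => i.val ≠ 0),
        v i (b i / ∑ j, b j) - b i = 1 / (4 * (2 * (n : ℝ) - 3) * ((n : ℝ) - 1)) := by
      intro i hi
      have hi0 : i.val ≠ 0 := (Finset.mem_filter.mp hi).2
      rw [hshare i]
      simp only [hv, hb, hi0, if_false]
      field_simp
      ring
    rw [Finset.sum_congr rfl hterm, Finset.sum_const, nsmul_eq_mul, hcard]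
    field_simp
end

section
/- Consider a Bayesian proportional allocation game with n bidders: for each bidder i there is a measurable type space Θ_i with probability measure F_i, types θ_1,…,θ_n are drawn independently (i.e., θ is distributed according to the product measure), and bidder i's valuation is a jointly measurable map V_i : Θ_i × [0,1] → ℝ such that for every θ_i, V_i(θ_i, ·) is concave, non-decreasing, non-negative, and θ_i ↦ V_i(θ_i, 1) is integrable. Let β_i : Θ_i → [0,∞) be measurable, integrable bid functions, let B_{−i}(θ) = Σ_{j≠i} β_j(θ_j), and d_i(θ) = β_i(θ_i)/Σ_j β_j(θ_j) (fractions with zero denominator equal 0). Suppose β is a pure Bayes-Nash equilibrium: for every i, F_i-almost every θ_i, and every y ≥ 0, E_{θ_{−i}}[V_i(θ_i, d_i(θ))] − β_i(θ_i) ≥ E_{θ_{−i}}[V_i(θ_i, y/(y+B_{−i}(θ)))] − y. Then for every measurable allocation x : Θ → ℝ^n with x_i(θ) ≥ 0 and Σ_i x_i(θ) ≤ 1 for all θ, it holds that E[Σ_i V_i(θ_i, d_i(θ))] ≥ (1/2)·E[Σ_i V_i(θ_i, x_i(θ))]. In particular, the price of anarchy of proportional allocation games over pure Bayes-Nash equilibria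 is at least 1/2. -/
open MeasureTheory

/-- Resampling one coordinate of a product probability measure does not change its law. -/
theorem measurePreserving_update_pi {ι : Type*} [Fintype ι] [DecidableEq ι] {Θ : ι → Type*}
    [∀ i, MeasurableSpace (Θ i)] (F : ∀ i, Measure (Θ i)) [∀ i, IsProbabilityMeasure (F i)]
    (i : ι) :
    MeasurePreserving (fun p : Θ i × (∀ j, Θ j) => Function.update p.2 i p.1)
      ((F i).prod (Measure.pi F)) (Measure.pi F) := by
  have hm : Measurable (fun p : Θ i × (∀ j, Θ j) => Function.update p.2 i p.1) := by
    refine measurable_pi_lambda _ fun j => ?_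
    by_cases h : j = i
    · subst h
      simpa using measurable_fst
    · simpa [Function.update_of_ne h, Function.comp_def] using
        (measurable_pi_apply j).comp measurable_snd
  refine ⟨hm, (Measure.pi_eq fun s hs => ?_).symm⟩
  rw [Measure.map_apply hm (MeasurableSet.univ_pi hs)]
  have hpre : (fun p : Θ i × (∀ j, Θ j) => Function.update p.2 i p.1) ⁻¹' Set.univ.pi s
      = s i ×ˢ Set.univ.pi (Function.update s i Set.univ) := by
    ext p
    simp only [Set.mem_preimage, Set.mem_univ_pi, Set.mem_prod]
    constructor
    · intro h
      refine ⟨by simpa using h i, fun j => ?_⟩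
      by_cases hj : j = i
      · subst hj
        simp
      · simpa [Function.update_of_ne hj] using h j
    · rintro ⟨h0, h⟩ j
      by_cases hj : j = i
      · subst hj
        simpa using h0
      · simpa [Function.update_of_ne hj] using h j
  rw [hpre, Measure.prod_prod, Measure.pi_pi,
    ← Finset.mul_prod_erase Finset.univ (fun j => F j (s j)) (Finset.mem_univ i),
    ← Finset.mul_prod_erase Finset.univ _ (Finset.mem_univ i)]
  simp only [Function.update_self, measure_univ, one_mul]
  congr 1
  refine Finset.prod_congr rfl fun j hj => ?_
  rw [Function.update_of_ne (Finset.ne_of_mem_erase hj)]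

/-- Bidding `t * m` against total competing bid `b` secures a share of the value of `t` that is
bounded below by an affine function of `b`. -/
theorem ConcaveOn.le_apply_proportional_share_s5 {v : ℝ → ℝ} (hc : ConcaveOn ℝ (Set.Icc 0 1) v)
    (hmono : MonotoneOn v (Set.Icc 0 1)) (hnn : ∀ t ∈ Set.Icc (0 : ℝ) 1, 0 ≤ v t)
    {t m b : ℝ} (ht : t ∈ Set.Icc (0 : ℝ) 1) (hm : 0 < m) (hb : 0 ≤ b) :
    v t * (3 / 4 - b / (4 * m)) ≤ v (t * m / (t * m + b)) := by
  obtain ⟨ht0, ht1⟩ := ht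
  have hmb : 0 < m + b := by linarith
  have htm : 0 ≤ t * m := by positivity
  set c := m / (m + b) with hcdef
  have hc0 : 0 ≤ c := by positivity
  have hc1 : c ≤ 1 := by rw [hcdef, div_le_one hmb]; linarith
  have hlin : 3 / 4 - b / (4 * m) ≤ c := by
    rw [hcdef, le_div_iff₀ hmb]
    have : (3 / 4 - b / (4 * m)) * (m + b) = m - (b - m) ^ 2 / (4 * m) := by
      field_simp
      ring
    rw [this]
    have : 0 ≤ (b - m) ^ 2 / (4 * m) := by positivity
    linarith
  have hz1 : t * m / (t * m + b) ≤ 1 := div_le_one_of_le₀ (by linarith) (by positivity)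
  have hz0 : 0 ≤ t * m / (t * m + b) := by positivity
  have hcz : c * t ≤ t * m / (t * m + b) := by
    rcases ht0.eq_or_lt with h | h
    · simp [← h]
    · have : 0 < t * m + b := by positivity
      rw [hcdef, div_mul_eq_mul_div, mul_comm m t]
      gcongr
      nlinarith
  have h0 : (0 : ℝ) ∈ Set.Icc (0 : ℝ) 1 := by simp
  have hconc := hc.2 (x := t) ⟨ht0, ht1⟩ (y := 0) h0 hc0 (sub_nonneg.2 hc1) (by ring)
  simp only [smul_eq_mul, mul_zero, add_zero] at hconc
  have hvt := hnn t ⟨ht0, ht1⟩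
  calc v t * (3 / 4 - b / (4 * m)) ≤ v t * c := by gcongr
    _ ≤ c * v t + (1 - c) * v 0 := by
      nlinarith [mul_nonneg (sub_nonneg.2 hc1) (hnn 0 h0)]
    _ ≤ v (c * t) := hconc
    _ ≤ v (t * m / (t * m + b)) :=
      hmono ⟨by positivity, by nlinarith⟩ ⟨hz0, hz1⟩ hcz

/-- If the competing bid has mean at most `m`, the bid `t * m` secures in expectation at least
half of the value of `t`. -/
theorem half_le_integral_apply_proportional_share {Ω : Type*} [MeasurableSpace Ω]
    {μ : Measure Ω} [IsProbabilityMeasure μ] {v : ℝ → ℝ} (hvm : Measurable v)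
    (hc : ConcaveOn ℝ (Set.Icc 0 1) v) (hmono : MonotoneOn v (Set.Icc 0 1))
    (hnn : ∀ t ∈ Set.Icc (0 : ℝ) 1, 0 ≤ v t) {B : Ω → ℝ} (hBm : Measurable B)
    (hB0 : ∀ ω, 0 ≤ B ω) (hBint : Integrable B μ) {m t : ℝ} (hm : 0 < m)
    (hBle : ∫ ω, B ω ∂μ ≤ m) (ht : t ∈ Set.Icc (0 : ℝ) 1) :
    v t / 2 ≤ ∫ ω, v (t * m / (t * m + B ω)) ∂μ := by
  have hmem : ∀ ω, t * m / (t * m + B ω) ∈ Set.Icc (0 : ℝ) 1 := fun ω => by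
    have := hB0 ω
    have := mul_nonneg ht.1 hm.le
    exact ⟨by positivity, div_le_one_of_le₀ (by linarith) (by positivity)⟩
  have hintegrable : Integrable (fun ω => v (t * m / (t * m + B ω))) μ := by
    refine Integrable.mono' (integrable_const (v 1))
      (hvm.comp (by fun_prop)).aestronglyMeasurable (ae_of_all _ fun ω => ?_)
    rw [Real.norm_of_nonneg (hnn _ (hmem ω))]
    exact hmono (hmem ω) (by simp) (hmem ω).2
  have hlin : Integrable (fun ω => v t * (3 / 4 - B ω / (4 * m))) μ :=
    ((integrable_const _).sub (hBint.div_const _)).const_mul _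
  have hle := integral_mono hlin hintegrable fun ω =>
    hc.le_apply_proportional_share_s5 hmono hnn ht hm (hB0 ω)
  refine le_trans ?_ hle
  rw [integral_const_mul, integral_sub (integrable_const _) (hBint.div_const _),
    integral_div (4 * m) B]
  have h4 : (∫ ω, B ω ∂μ) / (4 * m) ≤ 1 / 4 := by
    rw [div_le_iff₀ (by positivity)]
    linarith
  simp only [integral_const, probReal_univ, one_smul]
  nlinarith [hnn t ht]

/-- **Price of anarchy over pure Bayes-Nash equilibria.** In a Bayesian proportional allocation
game with independent types, at any pure Bayes-Nash equilibrium the expected social welfare is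
at least half the expected welfare of any feasible (type-dependent) allocation; in particular
the price of anarchy over pure Bayes-Nash equilibria is at least 1/2. -/
theorem stmt_5
    {n : ℕ} (Θ : Fin n → Type*) [∀ i, MeasurableSpace (Θ i)]
    (F : ∀ i, Measure (Θ i)) [∀ i, IsProbabilityMeasure (F i)]
    (V : ∀ i, Θ i → ℝ → ℝ)
    (hVmeas : ∀ i, Measurable (Function.uncurry (V i)))
    (hconc : ∀ i θi, ConcaveOn ℝ (Set.Icc 0 1) (V i θi))
    (hmono : ∀ i θi, MonotoneOn (V i θi) (Set.Icc 0 1))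
    (hnonneg : ∀ i θi, ∀ t ∈ Set.Icc (0:ℝ) 1, 0 ≤ V i θi t)
    (hVint : ∀ i, Integrable (fun θi => V i θi 1) (F i))
    (β : ∀ i, Θ i → ℝ)
    (hβmeas : ∀ i, Measurable (β i))
    (hβnonneg : ∀ i θi, 0 ≤ β i θi)
    (hβint : ∀ i, Integrable (β i) (F i))
    -- pure Bayes-Nash equilibrium: no bidder, for (almost) any of her types, gains by
    -- deviating to any deterministic bid `y ≥ 0`
    (heq : ∀ i, ∀ᵐ θi ∂(F i), ∀ y : ℝ, 0 ≤ y →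
      (∫ θ, V i θi (β i θi / ∑ j, β j (Function.update θ i θi j)) ∂(Measure.pi F))
          - β i θi ≥
        (∫ θ, V i θi (y / (y + ∑ j ∈ Finset.univ.erase i, β j (θ j))) ∂(Measure.pi F))
          - y)
    (x : (∀ i, Θ i) → Fin n → ℝ)
    (hxmeas : ∀ i, Measurable (fun θ => x θ i))
    (hxnonneg : ∀ θ i, 0 ≤ x θ i)
    (hxsum : ∀ θ, ∑ i, x θ i ≤ 1) :
    (∫ θ, ∑ i, V i (θ i) (β i (θ i) / ∑ j, β j (θ j)) ∂(Measure.pi F)) ≥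
      (1 / 2) * ∫ θ, ∑ i, V i (θ i) (x θ i) ∂(Measure.pi F) := by
  have hev : ∀ i, MeasurePreserving (fun θ : ∀ j, Θ j => θ i) (Measure.pi F) (F i) :=
    fun i => measurePreserving_eval F i
  have hintegrable : ∀ (i : Fin n) (f : (∀ j, Θ j) → ℝ), Measurable f →
      (∀ θ, f θ ∈ Set.Icc (0 : ℝ) 1) →
      Integrable (fun θ => V i (θ i) (f θ)) (Measure.pi F) := by
    intro i f hf hmem
    refine Integrable.mono' ((hev i).integrable_comp_of_integrable (hVint i))
      ((hVmeas i).comp ((measurable_pi_apply i).prodMk hf)).aestronglyMeasurable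
      (ae_of_all _ fun θ => ?_)
    rw [Real.norm_of_nonneg (hnonneg i _ _ (hmem θ))]
    exact hmono i _ (hmem θ) (by simp) (hmem θ).2
  have hβint' : ∀ i, Integrable (fun θ : ∀ j, Θ j => β i (θ i)) (Measure.pi F) :=
    fun i => (hev i).integrable_comp_of_integrable (hβint i)
  have hsum0 : ∀ (s : Finset (Fin n)) (θ : ∀ j, Θ j), 0 ≤ ∑ j ∈ s, β j (θ j) :=
    fun s θ => Finset.sum_nonneg fun j _ => hβnonneg j _
  have hβm : ∀ j, Measurable (fun θ : ∀ j, Θ j => β j (θ j)) :=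
    fun j => (hβmeas j).comp (measurable_pi_apply j)
  have hdm : ∀ i, Measurable (fun θ : ∀ j, Θ j => β i (θ i) / ∑ j, β j (θ j)) :=
    fun i => (hβm i).div (Finset.measurable_fun_sum _ fun j _ => hβm j)
  have hd01 : ∀ i (θ : ∀ j, Θ j), β i (θ i) / ∑ j, β j (θ j) ∈ Set.Icc (0 : ℝ) 1 :=
    fun i θ => ⟨div_nonneg (hβnonneg i _) (hsum0 _ θ),
      div_le_one_of_le₀ (Finset.single_le_sum (f := fun j => β j (θ j))
        (fun j _ => hβnonneg j _) (Finset.mem_univ i)) (hsum0 _ θ)⟩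
  have hx01 : ∀ i θ, x θ i ∈ Set.Icc (0 : ℝ) 1 := fun i θ =>
    ⟨hxnonneg θ i, (Finset.single_le_sum (f := fun j => x θ j)
      (fun j _ => hxnonneg θ j) (Finset.mem_univ i)).trans (hxsum θ)⟩
  have hxint : ∀ i, Integrable (fun θ => x θ i) (Measure.pi F) := fun i =>
    Integrable.mono' (integrable_const (1 : ℝ)) (hxmeas i).aestronglyMeasurable
      (ae_of_all _ fun θ => by
        rw [Real.norm_of_nonneg (hxnonneg θ i)]
        exact (hx01 i θ).2)
  have hdint := fun i => hintegrable i _ (hdm i) (hd01 i)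
  have hwint := fun i => hintegrable i _ (hxmeas i) (hx01 i)
  set M := ∑ i, ∫ θ, β i (θ i) ∂(Measure.pi F) with hM
  have hM0 : 0 ≤ M := Finset.sum_nonneg fun i _ => integral_nonneg fun θ => hβnonneg i _
  rw [ge_iff_le, integral_finsetSum _ fun i _ => hdint i, integral_finsetSum _ fun i _ => hwint i]
  refine le_of_forall_pos_le_add fun ε hε => ?_
  have hm : 0 < M + ε := by linarith
  have hbidder : ∀ i, (1 / 2) * (∫ θ, V i (θ i) (x θ i) ∂(Measure.pi F))
      - (∫ θ, x θ i ∂(Measure.pi F)) * (M + ε)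
      ≤ (∫ θ, V i (θ i) (β i (θ i) / ∑ j, β j (θ j)) ∂(Measure.pi F))
        - ∫ θ, β i (θ i) ∂(Measure.pi F) := by
    intro i
    set U : Θ i → ℝ := fun θi =>
      ∫ θ, V i θi (β i θi / ∑ j, β j (Function.update θ i θi j)) ∂(Measure.pi F) with hU
    have hmp := measurePreserving_update_pi F i
    have hcomp : Integrable (fun p : Θ i × (∀ j, Θ j) =>
        V i p.1 (β i p.1 / ∑ j, β j (Function.update p.2 i p.1 j)))
        ((F i).prod (Measure.pi F)) := by
      simpa [Function.comp_def] using hmp.integrable_comp_of_integrable (hdint i)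
    have hUint : Integrable U (F i) := hcomp.integral_prod_left
    have hUeq : ∫ θ, U (θ i) ∂(Measure.pi F)
        = ∫ θ, V i (θ i) (β i (θ i) / ∑ j, β j (θ j)) ∂(Measure.pi F) := by
      have h1 : ∫ θ, U (θ i) ∂(Measure.pi F) = ∫ θi, U θi ∂(F i) := by
        rw [← (hev i).map_eq, integral_map (hev i).aemeasurable]
        rw [(hev i).map_eq]
        exact hUint.aestronglyMeasurable
      have h2 : ∫ θi, U θi ∂(F i) = ∫ p : Θ i × (∀ j, Θ j),
          V i p.1 (β i p.1 / ∑ j, β j (Function.update p.2 i p.1 j))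
            ∂((F i).prod (Measure.pi F)) := (integral_prod _ hcomp).symm
      rw [h1, h2]
      conv_rhs => rw [← hmp.map_eq]
      rw [integral_map hmp.aemeasurable]
      · simp
      · rw [hmp.map_eq]
        exact (hdint i).aestronglyMeasurable
    have hpoint : ∀ᵐ θi ∂(F i), ∀ t ∈ Set.Icc (0 : ℝ) 1,
        (1 / 2) * V i θi t - t * (M + ε) ≤ U θi - β i θi := by
      filter_upwards [heq i] with θi h t ht
      have hdev := h (t * (M + ε)) (mul_nonneg ht.1 hm.le)
      have hBle : ∫ θ, ∑ j ∈ Finset.univ.erase i, β j (θ j) ∂(Measure.pi F) ≤ M + ε := by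
        rw [integral_finsetSum _ fun j _ => hβint' j]
        have : ∑ j ∈ Finset.univ.erase i, ∫ θ, β j (θ j) ∂(Measure.pi F) ≤ M :=
          Finset.sum_le_sum_of_subset_of_nonneg (Finset.erase_subset _ _)
            fun j _ _ => integral_nonneg fun θ => hβnonneg j _
        linarith
      have hhalf := half_le_integral_apply_proportional_share (μ := Measure.pi F) (v := V i θi)
        ((hVmeas i).comp measurable_prodMk_left)
        (hconc i θi) (hmono i θi) (hnonneg i θi)
        (Finset.measurable_fun_sum _ fun j _ => hβm j) (hsum0 (Finset.univ.erase i))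
        (integrable_finsetSum _ fun j _ => hβint' j) hm hBle ht
      simp only [hU]
      linarith
    have hae : ∀ᵐ θ ∂(Measure.pi F),
        (1 / 2) * V i (θ i) (x θ i) - x θ i * (M + ε) ≤ U (θ i) - β i (θ i) := by
      filter_upwards [(hev i).quasiMeasurePreserving.ae hpoint] with θ h
      exact h _ (hx01 i θ)
    have hUint' : Integrable (fun θ : ∀ j, Θ j => U (θ i)) (Measure.pi F) :=
      (hev i).integrable_comp_of_integrable hUint
    have hle := integral_mono_ae (((hwint i).const_mul (1 / 2)).sub ((hxint i).mul_const _))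
      (hUint'.sub (hβint' i)) hae
    simp only [Pi.sub_apply] at hle
    rwa [integral_sub ((hwint i).const_mul _) ((hxint i).mul_const _),
      integral_sub hUint' (hβint' i), integral_const_mul, integral_mul_const, hUeq] at hle
  have hsum := Finset.sum_le_sum fun i (_ : i ∈ Finset.univ) => hbidder i
  rw [Finset.sum_sub_distrib, Finset.sum_sub_distrib, ← Finset.mul_sum, ← Finset.sum_mul,
    ← hM] at hsum
  have hX : ∑ i, ∫ θ, x θ i ∂(Measure.pi F) ≤ 1 := by
    rw [← integral_finsetSum _ fun i _ => hxint i]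
    calc ∫ θ, ∑ i, x θ i ∂(Measure.pi F) ≤ ∫ _θ, (1 : ℝ) ∂(Measure.pi F) :=
          integral_mono (integrable_finsetSum _ fun i _ => hxint i) (integrable_const _) hxsum
      _ = 1 := by simp
  nlinarith [mul_le_mul_of_nonneg_right hX hm.le]
end

section
/- Consider n budget-constrained bidders where bidder i has a concave, non-decreasing, non-negative valuation v_i : [0,1] → ℝ and budget c_i ≥ 0. Let b = (b_1,…,b_n) be a (possibly correlated) random bid vector with 0 ≤ b_i ≤ c_i almost surely, let B_{−i} = Σ_{j≠i} b_j and d_i = b_i/Σ_j b_j (fractions with zero denominator equal 0). Suppose b is a coarse-correlated equilibrium among budget-feasible deviations: for every i and every y ∈ [0, c_i], E[v_i(d_i) − b_i] ≥ E[v_i(y/(y+B_{−i}))] − y. Then for every allocation (x_1,…,x_n) with x_i ≥ 0 and Σ_i x_i ≤ 1, the effective welfare satisfies Σ_i min{E[v_i(d_i)], c_i} ≥ ((7−√17)/8)·Σ_i min{v_i(x_i), c_i}. (Note (7−√17)/8 ≈ 0.3596.) -/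
open MeasureTheory

theorem ConcaveOn.mul_le_of_mul_le {v : ℝ → ℝ} (hconc : ConcaveOn ℝ (Set.Icc 0 1) v)
    (hmono : MonotoneOn v (Set.Icc 0 1)) (hnonneg : ∀ t ∈ Set.Icc (0 : ℝ) 1, 0 ≤ v t)
    {x t r : ℝ} (hx : x ∈ Set.Icc (0 : ℝ) 1) (ht : t ∈ Set.Icc (0 : ℝ) 1)
    (hr : r ∈ Set.Icc (0 : ℝ) 1) (hrt : r * x ≤ t) : r * v x ≤ v t := by
  have h0 : (0 : ℝ) ∈ Set.Icc (0 : ℝ) 1 := ⟨le_rfl, zero_le_one⟩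
  have hscale := hconc.2 hx h0 hr.1 (sub_nonneg.2 hr.2) (by ring)
  simp only [smul_eq_mul, mul_zero, add_zero] at hscale
  have hrx : r * x ∈ Set.Icc (0 : ℝ) 1 :=
    ⟨mul_nonneg hr.1 hx.1, mul_le_one₀ hr.2 hx.1 hx.2⟩
  have hle := hmono hrx ht hrt
  have hrest := mul_nonneg (sub_nonneg.2 hr.2) (hnonneg 0 h0)
  linarith

/-- The tangent line of the convex function `s ↦ 2β / (2β + 3s)` at `s = β`. -/
theorem tangent_le_proportional_share {β s : ℝ} (hβ : 0 < β) (hs : 0 ≤ s) :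
    2 / 5 - 6 / 25 * (s / β - 1) ≤ 2 * β / (2 * β + 3 * s) := by
  rw [le_div_iff₀ (by positivity)]
  have hsβ : s = s / β * β := by field_simp
  have hz : 0 ≤ s / β := by positivity
  generalize s / β = z at hsβ hz ⊢
  subst hsβ
  nlinarith [mul_nonneg hβ.le (sq_nonneg (z - 1))]

/-- A deviation to two thirds of `x` times the expected total bid `β` against total bid `s`,
of which others contribute `o`. -/
theorem deviation_value_ge {v : ℝ → ℝ} (hconc : ConcaveOn ℝ (Set.Icc 0 1) v)
    (hmono : MonotoneOn v (Set.Icc 0 1)) (hnonneg : ∀ t ∈ Set.Icc (0 : ℝ) 1, 0 ≤ v t)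
    {x β o s : ℝ} (hx : x ∈ Set.Icc (0 : ℝ) 1) (hβ : 0 < β) (ho : 0 ≤ o) (hos : o ≤ s) :
    (2 / 5 - 6 / 25 * (s / β - 1)) * v x ≤
      v (2 / 3 * x * β / (2 / 3 * x * β + o)) := by
  have hs : 0 ≤ s := ho.trans hos
  have hy : 0 ≤ 2 / 3 * x * β := by have := hx.1; positivity
  refine (mul_le_mul_of_nonneg_right (tangent_le_proportional_share hβ hs)
    (hnonneg x hx)).trans (hconc.mul_le_of_mul_le hmono hnonneg hx ⟨by positivity, ?_⟩
      ⟨by positivity, ?_⟩ ?_)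
  · exact div_le_one_of_le₀ (by linarith) (by positivity)
  · exact div_le_one_of_le₀ (by linarith) (by positivity)
  · rcases hx.1.eq_or_lt with h | h
    · simp [← h]
    · rw [div_mul_eq_mul_div, div_le_div_iff₀ (by positivity) (by positivity)]
      have h1 : x * β ≤ β := by nlinarith [hx.2]
      have h2 : 0 ≤ x * β := by positivity
      nlinarith [mul_le_mul_of_nonneg_left h1 h2, mul_le_mul_of_nonneg_left hos h2]

/-- **Effective-welfare price of anarchy with budgets (full information).** At any
coarse-correlated equilibrium (with deviations restricted to each bidder's budget) of a
proportional allocation game with budget-constrained bidders, the effective welfare is at least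
`(7 - √17)/8 ≈ 0.3596` times the effective welfare of any feasible allocation. -/
theorem stmt_6
    {Ω : Type*} [MeasurableSpace Ω] (P : Measure Ω) [IsProbabilityMeasure P]
    (n : ℕ) (v : Fin n → ℝ → ℝ) (c : Fin n → ℝ)
    (hconc : ∀ i, ConcaveOn ℝ (Set.Icc 0 1) (v i))
    (hmono : ∀ i, MonotoneOn (v i) (Set.Icc 0 1))
    (hnonneg : ∀ i, ∀ t ∈ Set.Icc (0:ℝ) 1, 0 ≤ v i t)
    (hc : ∀ i, 0 ≤ c i)
    (b : Fin n → Ω → ℝ)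
    (hbmeas : ∀ i, Measurable (b i))
    (hbint : ∀ i, Integrable (b i) P)
    (hb : ∀ i, ∀ᵐ ω ∂P, 0 ≤ b i ω ∧ b i ω ≤ c i)
    (hdint : ∀ i, Integrable (fun ω => v i (b i ω / ∑ j, b j ω)) P)
    (hdevint : ∀ i (y : ℝ),
      Integrable (fun ω => v i (y / (y + ∑ j ∈ Finset.univ.erase i, b j ω))) P)
    -- coarse-correlated equilibrium among budget-feasible deviations
    (heq : ∀ i, ∀ y ∈ Set.Icc 0 (c i),
      (∫ ω, (v i (b i ω / ∑ j, b j ω) - b i ω) ∂P) ≥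
        (∫ ω, v i (y / (y + ∑ j ∈ Finset.univ.erase i, b j ω)) ∂P) - y)
    (x : Fin n → ℝ) (hx : ∀ i, 0 ≤ x i) (hxsum : ∑ i, x i ≤ 1) :
    ∑ i, min (∫ ω, v i (b i ω / ∑ j, b j ω) ∂P) (c i) ≥
      (7 - Real.sqrt 17) / 8 * ∑ i, min (v i (x i)) (c i) := by
  have hball : ∀ᵐ ω ∂P, ∀ i, 0 ≤ b i ω ∧ b i ω ≤ c i := ae_all_iff.2 hb
  set β : ℝ := ∑ i, ∫ ω, b i ω ∂P with hβdef
  have hSint : Integrable (fun ω => ∑ j, b j ω) P := integrable_finsetSum _ fun j _ => hbint j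
  have hSβ : ∫ ω, ∑ j, b j ω ∂P = β := integral_finsetSum _ fun j _ => hbint j
  have he0 : ∀ i, 0 ≤ ∫ ω, b i ω ∂P := fun i =>
    integral_nonneg_of_ae ((hb i).mono fun ω h => h.1)
  have hec : ∀ i, ∫ ω, b i ω ∂P ≤ c i := fun i => by
    simpa using integral_mono_ae (hbint i) (integrable_const (c i)) ((hb i).mono fun ω h => h.2)
  have hdev : ∀ i, ∀ y ∈ Set.Icc 0 (c i),
      (∫ ω, v i (y / (y + ∑ j ∈ Finset.univ.erase i, b j ω)) ∂P) - y ≤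
        (∫ ω, v i (b i ω / ∑ j, b j ω) ∂P) - ∫ ω, b i ω ∂P := fun i y hy => by
    have h := heq i y hy
    rwa [integral_sub (hdint i) (hbint i)] at h
  have heU : ∀ i, ∫ ω, b i ω ∂P ≤ ∫ ω, v i (b i ω / ∑ j, b j ω) ∂P := fun i => by
    have h := hdev i 0 ⟨le_rfl, hc i⟩
    have h0 := hnonneg i 0 ⟨le_rfl, zero_le_one⟩
    simp only [zero_div, integral_const, probReal_univ, one_smul] at h
    linarith
  have hx1 : ∀ i, x i ≤ 1 := fun i =>
    (Finset.single_le_sum (fun j _ => hx j) (Finset.mem_univ i)).trans hxsum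
  have hβ0 : 0 ≤ β := Finset.sum_nonneg fun i _ => he0 i
  have hbidder : ∀ i, min (v i (x i)) (c i) ≤
      8 / 3 * min (∫ ω, v i (b i ω / ∑ j, b j ω) ∂P) (c i) - 5 / 3 * ∫ ω, b i ω ∂P
        + 5 / 3 * x i * β := fun i => by
    have hVv := min_le_left (v i (x i)) (c i)
    have hVc := min_le_right (v i (x i)) (c i)
    have hxβ := mul_nonneg (hx i) hβ0
    have hei := he0 i
    have hvx := hnonneg i (x i) ⟨hx i, hx1 i⟩
    rcases le_or_gt (c i) (∫ ω, v i (b i ω / ∑ j, b j ω) ∂P) with hU | hU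
    · rw [min_eq_right hU]
      linarith [hec i]
    rw [min_eq_left hU.le]
    have heUi := heU i
    rcases hβ0.eq_or_lt with hβz | hβpos
    · have hz : ∀ᵐ ω ∂P, ∀ j, b j ω = 0 := ae_all_iff.2 fun j => by
        have hj : ∫ ω, b j ω ∂P = 0 :=
          (Finset.sum_eq_zero_iff_of_nonneg fun k _ => he0 k).1 hβz.symm j (Finset.mem_univ j)
        exact (integral_eq_zero_iff_of_nonneg_ae ((hb j).mono fun ω h => h.1) (hbint j)).1 hj
      have hv1 : v i 1 ≤ ∫ ω, v i (b i ω / ∑ j, b j ω) ∂P := by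
        refine le_of_forall_pos_le_add fun ε hε => ?_
        have hy : 0 < min ε (c i) := lt_min hε (by linarith)
        have h := hdev i (min ε (c i)) ⟨hy.le, min_le_right _ _⟩
        have hcongr : ∫ ω, v i (min ε (c i) /
            (min ε (c i) + ∑ j ∈ Finset.univ.erase i, b j ω)) ∂P = ∫ _, v i 1 ∂P :=
          integral_congr_ae (hz.mono fun ω hω => by simp [hω, div_self hy.ne'])
        rw [hcongr] at h
        simp only [integral_const, probReal_univ, one_smul] at h
        linarith [min_le_left ε (c i)]
      have hle := hmono i ⟨hx i, hx1 i⟩ ⟨zero_le_one, le_rfl⟩ (hx1 i)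
      linarith
    · rcases le_or_gt (2 / 3 * x i * β) (c i) with hy | hy
      · have hmain : 2 / 5 * v i (x i) ≤ ∫ ω, v i (2 / 3 * x i * β /
            (2 / 3 * x i * β + ∑ j ∈ Finset.univ.erase i, b j ω)) ∂P := by
          have hlin : Integrable (fun ω => 6 / 25 * ((∑ j, b j ω) / β - 1)) P :=
            ((hSint.div_const β).sub (integrable_const 1)).const_mul _
          have hcalc : ∫ ω, (2 / 5 - 6 / 25 * ((∑ j, b j ω) / β - 1)) * v i (x i) ∂P
              = 2 / 5 * v i (x i) := by
            rw [integral_mul_const, integral_sub (integrable_const _) hlin, integral_const_mul,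
              integral_sub (hSint.div_const β) (integrable_const 1), integral_div β, hSβ,
              div_self hβpos.ne']
            simp
          rw [← hcalc]
          refine integral_mono_ae (((integrable_const _).sub hlin).mul_const _)
            (hdevint i _) (hball.mono fun ω hω => ?_)
          refine deviation_value_ge (hconc i) (hmono i) (hnonneg i) ⟨hx i, hx1 i⟩ hβpos
            (Finset.sum_nonneg fun j _ => (hω j).1) ?_
          exact Finset.sum_le_sum_of_subset_of_nonneg (Finset.erase_subset _ _)
            fun j _ _ => (hω j).1
        have h := hdev i _ ⟨by have := hx i; positivity, hy⟩
        linarith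
      · linarith
  have hsum := Finset.sum_le_sum fun i (_ : i ∈ Finset.univ) => hbidder i
  rw [Finset.sum_add_distrib, Finset.sum_sub_distrib, ← Finset.mul_sum, ← Finset.mul_sum,
    ← Finset.sum_mul, ← Finset.mul_sum, ← hβdef] at hsum
  have hxβ : (∑ i, x i) * β ≤ β := mul_le_of_le_one_left hβ0 hxsum
  have hV0 : 0 ≤ ∑ i, min (v i (x i)) (c i) :=
    Finset.sum_nonneg fun i _ => le_min (hnonneg i _ ⟨hx i, hx1 i⟩) (hc i)
  have hκ : (7 - Real.sqrt 17) / 8 ≤ 3 / 8 := by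
    have : (4 : ℝ) ≤ Real.sqrt 17 := Real.le_sqrt_of_sq_le (by norm_num)
    linarith
  have := mul_le_mul_of_nonneg_right hκ hV0
  nlinarith
end

section
/- Consider a Bayesian proportional allocation game with budget-constrained bidders: for each bidder i there is a measurable type space Θ_i with probability measure F_i, types drawn independently; bidder i's valuation is a jointly measurable V_i : Θ_i × [0,1] → ℝ with V_i(θ_i,·) concave, non-decreasing, non-negative for every θ_i and θ_i ↦ V_i(θ_i,1) integrable, and her budget is a measurable c_i : Θ_i → [0,∞). Let β_i : Θ_i → ℝ be measurable integrable bid functions with 0 ≤ β_i(θ_i) ≤ c_i(θ_i), and let d_i(θ) = β_i(θ_i)/Σ_j β_j(θ_j), B_{−i}(θ) = Σ_{j≠i} β_j(θ_j) (fractions with zero denominator equal 0). Suppose β is a pure Bayes-Nash equilibrium among budget-feasible deviations: for every i, F_i-almost every θ_i, and every y ∈ [0, c_i(θ_i)], E_{θ_{−i}}[V_i(θ_i, d_i(θ))] − β_i(θ_i) ≥ E_{θ_{−i}}[V_i(θ_i, y/(y+B_{−i}(θ)))] − y. Then for every measurable allocation x : Θ → ℝ^n with x_i(θ) ≥ 0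 and Σ_i x_i(θ) ≤ 1, we have Σ_i E_{θ_i}[min{E_{θ_{−i}}[V_i(θ_i, d_i(θ))], c_i(θ_i)}] ≥ ((7−√17)/8)·Σ_i E_{θ_i}[min{E_{θ_{−i}}[V_i(θ_i, x_i(θ))], c_i(θ_i)}]. (Note (7−√17)/8 ≈ 0.3596.) -/
open MeasureTheory

/-- A concave function on `[0, 1]` has a supporting line at every interior point. -/
theorem ConcaveOn.exists_supporting_line {f : ℝ → ℝ} (hf : ConcaveOn ℝ (Set.Icc 0 1) f) {z : ℝ}
    (hz : z ∈ Set.Ioo (0 : ℝ) 1) :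
    ∃ m : ℝ, ∀ t ∈ Set.Icc (0 : ℝ) 1, f t ≤ f z + m * (t - z) := by
  have hg : ConvexOn ℝ (Set.Icc 0 1) (-f) := hf.neg
  have hzi : z ∈ interior (Set.Icc (0 : ℝ) 1) := by rwa [interior_Icc]
  refine ⟨-derivWithin (-f) (Set.Ioi z) z, fun t ht => ?_⟩
  rcases lt_trichotomy t z with h | h | h
  · have h1 := (hg.slope_le_leftDeriv_of_mem_interior ht hzi h).trans
      (hg.leftDeriv_le_rightDeriv_of_mem_interior hzi)
    rw [slope_def_field, div_le_iff₀ (by linarith)] at h1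
    simp only [Pi.neg_apply] at h1
    linarith
  · simp [h]
  · have h1 := hg.rightDeriv_le_slope_of_mem_interior hzi ht h
    rw [slope_def_field, le_div_iff₀ (by linarith)] at h1
    simp only [Pi.neg_apply] at h1
    linarith

theorem integrable_of_mem_Icc {Ω : Type*} [MeasurableSpace Ω] {μ : Measure Ω}
    [IsFiniteMeasure μ] {f : Ω → ℝ} (hf : AEStronglyMeasurable f μ) {a b : ℝ}
    (h : ∀ ω, f ω ∈ Set.Icc a b) : Integrable f μ :=
  Integrable.of_mem_Icc a b hf.aemeasurable (ae_of_all _ h)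

theorem integrable_monotoneOn_comp {Ω : Type*} [MeasurableSpace Ω] {μ : Measure Ω}
    [IsFiniteMeasure μ] {f : ℝ → ℝ} (hfm : Measurable f) (hmono : MonotoneOn f (Set.Icc 0 1))
    {X : Ω → ℝ} (hX : Measurable X) (hX01 : ∀ ω, X ω ∈ Set.Icc (0 : ℝ) 1) :
    Integrable (fun ω => f (X ω)) μ :=
  integrable_of_mem_Icc (a := f 0) (b := f 1) (hfm.comp hX).aestronglyMeasurable fun ω =>
    ⟨hmono (by simp) (hX01 ω) (hX01 ω).1, hmono (hX01 ω) (by simp) (hX01 ω).2⟩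

/-- Jensen's inequality for a concave non-decreasing function on `[0, 1]`, which need not be
continuous at `0`. -/
theorem ConcaveOn.integral_comp_le_of_monotoneOn {Ω : Type*} [MeasurableSpace Ω] {μ : Measure Ω}
    [IsProbabilityMeasure μ] {f : ℝ → ℝ} (hfm : Measurable f)
    (hconc : ConcaveOn ℝ (Set.Icc 0 1) f) (hmono : MonotoneOn f (Set.Icc 0 1))
    {X : Ω → ℝ} (hX : Measurable X) (hX01 : ∀ ω, X ω ∈ Set.Icc (0 : ℝ) 1) :
    ∫ ω, f (X ω) ∂μ ≤ f (∫ ω, X ω ∂μ) := by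
  have hXi : Integrable X μ := integrable_of_mem_Icc hX.aestronglyMeasurable hX01
  have hfi := integrable_monotoneOn_comp (μ := μ) hfm hmono hX hX01
  have h0 : 0 ≤ ∫ ω, X ω ∂μ := integral_nonneg fun ω => (hX01 ω).1
  have h1 : ∫ ω, X ω ∂μ ≤ 1 := by
    simpa using integral_mono hXi (integrable_const (1 : ℝ)) fun ω => (hX01 ω).2
  rcases h0.eq_or_lt with h0 | h0
  · have hae : X =ᵐ[μ] 0 :=
      (integral_eq_zero_iff_of_nonneg (fun ω => (hX01 ω).1) hXi).1 h0.symm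
    rw [← h0, integral_congr_ae (g := fun _ => f 0) (hae.mono fun ω h => by simp [h])]
    simp
  rcases h1.eq_or_lt with h1 | h1
  · rw [h1]
    simpa using integral_mono hfi (integrable_const (f 1)) fun ω =>
      hmono (hX01 ω) (by simp) (hX01 ω).2
  obtain ⟨m, hm⟩ := hconc.exists_supporting_line ⟨h0, h1⟩
  set z := ∫ ω, X ω ∂μ with hz
  have hlin : Integrable (fun ω => m * (X ω - z)) μ :=
    (hXi.sub (integrable_const z)).const_mul m
  refine (integral_mono hfi ((integrable_const (f z)).add hlin) fun ω => hm _ (hX01 ω)).trans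
    (le_of_eq ?_)
  simp only [Pi.add_apply]
  rw [integral_add (integrable_const _) hlin, integral_const_mul,
    integral_sub hXi (integrable_const _)]
  simp [← hz]

/-- Bidding `3/5 * z * P` against random competing bids of mean at most `P` secures in expectation
a `3/8` fraction of the value of the share `z`. -/
theorem ConcaveOn.le_integral_proportional_share {Ω : Type*} [MeasurableSpace Ω] {μ : Measure Ω}
    [IsProbabilityMeasure μ] {f : ℝ → ℝ} (hfm : Measurable f)
    (hconc : ConcaveOn ℝ (Set.Icc 0 1) f) (hmono : MonotoneOn f (Set.Icc 0 1))
    (hnonneg : ∀ t ∈ Set.Icc (0 : ℝ) 1, 0 ≤ f t)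
    {B : Ω → ℝ} (hB : Measurable B) (hBi : Integrable B μ) (hB0 : ∀ ω, 0 ≤ B ω)
    {P : ℝ} (hP : 0 < P) (hBP : ∫ ω, B ω ∂μ ≤ P) {z : ℝ} (hz : z ∈ Set.Icc (0 : ℝ) 1) :
    3 / 8 * f z ≤ ∫ ω, f (3 / 5 * z * P / (3 / 5 * z * P + B ω)) ∂μ := by
  have hz0 := hz.1
  have hy : 0 ≤ 3 / 5 * z * P := by positivity
  have hfz := hnonneg z hz
  have hshare : ∀ ω, 3 / 5 * z * P / (3 / 5 * z * P + B ω) ∈ Set.Icc (0 : ℝ) 1 := fun ω =>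
    ⟨by have := hB0 ω; positivity,
      div_le_one_of_le₀ (by linarith [hB0 ω]) (by linarith [hB0 ω])⟩
  have hpt : ∀ ω, f z * (3 / 8 + 15 / 64 * (1 - B ω / P)) ≤
      f (3 / 5 * z * P / (3 / 5 * z * P + B ω)) := by
    intro ω
    have hb := hB0 ω
    set s : ℝ := 3 / 5 * P / (3 / 5 * P + B ω) with hs
    have hden : 0 < 3 / 5 * P + B ω := by positivity
    have hs0 : 0 ≤ s := by positivity
    have hs1 : s ≤ 1 := div_le_one_of_le₀ (by linarith) hden.le
    have htangent : 3 / 8 + 15 / 64 * (1 - B ω / P) ≤ s := by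
      rw [hs, le_div_iff₀ hden, ← sub_nonneg]
      have : 3 / 5 * P - (3 / 8 + 15 / 64 * (1 - B ω / P)) * (3 / 5 * P + B ω) =
          15 / 64 * (B ω - P) ^ 2 / P := by
        field_simp
        ring
      rw [this]
      positivity
    have hscale : f z * s ≤ f (s * z) := by
      have h := hconc.2 hz (Set.left_mem_Icc.2 zero_le_one) hs0 (sub_nonneg.2 hs1)
        (by ring)
      simp only [smul_eq_mul, mul_zero, add_zero] at h
      nlinarith [mul_nonneg (sub_nonneg.2 hs1) (hnonneg 0 (by simp))]
    have hle : s * z ≤ 3 / 5 * z * P / (3 / 5 * z * P + B ω) := by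
      rcases hz0.eq_or_lt with h | h
      · simp [← h]
      have hd : 0 < 3 / 5 * z * P + B ω := by positivity
      rw [hs, div_mul_eq_mul_div, div_le_div_iff₀ hden hd]
      have : z * P ≤ P := mul_le_of_le_one_left hP.le hz.2
      nlinarith [mul_nonneg hy (sub_nonneg.2 this)]
    have hmem : s * z ∈ Set.Icc (0 : ℝ) 1 :=
      ⟨mul_nonneg hs0 hz0, mul_le_one₀ hs1 hz0 hz.2⟩
    calc _ ≤ f z * s := mul_le_mul_of_nonneg_left htangent hfz
      _ ≤ _ := hscale
      _ ≤ _ := hmono hmem (hshare ω) hle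
  have hlin : Integrable (fun ω => f z * (3 / 8 + 15 / 64 * (1 - B ω / P))) μ := by fun_prop
  have hint := integrable_monotoneOn_comp (μ := μ) hfm hmono
    (X := fun ω => 3 / 5 * z * P / (3 / 5 * z * P + B ω)) (by fun_prop) hshare
  refine le_trans ?_ (integral_mono hlin hint hpt)
  rw [integral_const_mul, integral_add (by fun_prop) (by fun_prop), integral_const_mul,
    integral_sub (by fun_prop) (by fun_prop)]
  simp only [integral_div, integral_const, probReal_univ, smul_eq_mul, one_mul]
  have : (∫ ω, B ω ∂μ) / P ≤ 1 := (div_le_one hP).2 hBP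
  nlinarith

/-- The interim expected value capped by the budget is integrable in the bidder's own type. -/
theorem integrable_min_integral_comp {T Ω : Type*} [MeasurableSpace T] [MeasurableSpace Ω]
    {ν : Measure T} [IsFiniteMeasure ν] {μ : Measure Ω} [IsProbabilityMeasure μ]
    {v : T → ℝ → ℝ} (hv : Measurable (Function.uncurry v))
    (hmono : ∀ t, MonotoneOn (v t) (Set.Icc 0 1))
    (hnonneg : ∀ t, ∀ a ∈ Set.Icc (0 : ℝ) 1, 0 ≤ v t a)
    (hint : Integrable (fun t => v t 1) ν) {c : T → ℝ} (hc : Measurable c) (hc0 : ∀ t, 0 ≤ c t)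
    {a : T → Ω → ℝ} (ha : Measurable (Function.uncurry a))
    (ha01 : ∀ t ω, a t ω ∈ Set.Icc (0 : ℝ) 1) :
    Integrable (fun t => min (∫ ω, v t (a t ω) ∂μ) (c t)) ν := by
  have hva : Measurable (Function.uncurry fun t ω => v t (a t ω)) :=
    hv.comp (measurable_fst.prodMk ha)
  have hI : Measurable fun t => ∫ ω, v t (a t ω) ∂μ :=
    (hva.stronglyMeasurable.integral_prod_right (ν := μ)).measurable
  refine hint.mono' (hI.min hc).aestronglyMeasurable (ae_of_all _ fun t => ?_)
  have h0 : 0 ≤ ∫ ω, v t (a t ω) ∂μ := integral_nonneg fun ω => hnonneg t _ (ha01 t ω)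
  rw [Real.norm_of_nonneg (le_min h0 (hc0 t))]
  refine (min_le_left _ _).trans ?_
  have hvt : Measurable (v t) := hv.comp measurable_prodMk_left
  have hat : Measurable (a t) := ha.comp measurable_prodMk_left
  simpa using integral_mono (integrable_monotoneOn_comp (μ := μ) hvt (hmono t) hat (ha01 t))
    (integrable_const (v t 1)) fun ω => hmono t (ha01 t ω) (by simp) (ha01 t ω).2

/-- **Effective-welfare price of anarchy with budgets (Bayesian setting).** In a Bayesian
proportional allocation game with independently drawn types determining valuations and budgets,
at any pure Bayes-Nash equilibrium (with deviations restricted to budgets) the effective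
welfare is at least `(7 - √17)/8 ≈ 0.3596` times the effective welfare of any feasible
type-dependent allocation. -/
theorem stmt_7
    {n : ℕ} (Θ : Fin n → Type*) [∀ i, MeasurableSpace (Θ i)]
    (F : ∀ i, Measure (Θ i)) [∀ i, IsProbabilityMeasure (F i)]
    (V : ∀ i, Θ i → ℝ → ℝ)
    (hVmeas : ∀ i, Measurable (Function.uncurry (V i)))
    (hconc : ∀ i θi, ConcaveOn ℝ (Set.Icc 0 1) (V i θi))
    (hmono : ∀ i θi, MonotoneOn (V i θi) (Set.Icc 0 1))
    (hnonneg : ∀ i θi, ∀ t ∈ Set.Icc (0:ℝ) 1, 0 ≤ V i θi t)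
    (hVint : ∀ i, Integrable (fun θi => V i θi 1) (F i))
    (c : ∀ i, Θ i → ℝ)
    (hcmeas : ∀ i, Measurable (c i))
    (hcnonneg : ∀ i θi, 0 ≤ c i θi)
    (β : ∀ i, Θ i → ℝ)
    (hβmeas : ∀ i, Measurable (β i))
    (hβint : ∀ i, Integrable (β i) (F i))
    (hβfeas : ∀ i θi, 0 ≤ β i θi ∧ β i θi ≤ c i θi)
    -- pure Bayes-Nash equilibrium among budget-feasible deviations
    (heq : ∀ i, ∀ᵐ θi ∂(F i), ∀ y ∈ Set.Icc 0 (c i θi),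
      (∫ θ, V i θi (β i θi / ∑ j, β j (Function.update θ i θi j)) ∂(Measure.pi F))
          - β i θi ≥
        (∫ θ, V i θi (y / (y + ∑ j ∈ Finset.univ.erase i, β j (θ j))) ∂(Measure.pi F))
          - y)
    (x : (∀ i, Θ i) → Fin n → ℝ)
    (hxmeas : ∀ i, Measurable (fun θ => x θ i))
    (hxnonneg : ∀ θ i, 0 ≤ x θ i)
    (hxsum : ∀ θ, ∑ i, x θ i ≤ 1) :
    ∑ i, ∫ θi, min
        (∫ θ, V i θi (β i θi / ∑ j, β j (Function.update θ i θi j)) ∂(Measure.pi F))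
        (c i θi) ∂(F i) ≥
      (7 - Real.sqrt 17) / 8 * ∑ i, ∫ θi, min
        (∫ θ, V i θi (x (Function.update θ i θi) i) ∂(Measure.pi F))
        (c i θi) ∂(F i) := by
  have hx01 : ∀ θ i, x θ i ∈ Set.Icc (0 : ℝ) 1 := fun θ i =>
    ⟨hxnonneg θ i, (Finset.single_le_sum (fun j _ => hxnonneg θ j) (Finset.mem_univ i)).trans
      (hxsum θ)⟩
  have hupd : ∀ i, Measurable (fun p : Θ i × (∀ j, Θ j) => Function.update p.2 i p.1) :=
    fun i => (measurePreserving_update_pi F i).measurable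
  have hd01 : ∀ i θi θ, β i θi / ∑ j, β j (Function.update θ i θi j) ∈ Set.Icc (0 : ℝ) 1 := by
    intro i θi θ
    have hle : β i θi ≤ ∑ j, β j (Function.update θ i θi j) := by
      simpa using Finset.single_le_sum (f := fun j => β j (Function.update θ i θi j))
        (fun j _ => (hβfeas j _).1) (Finset.mem_univ i)
    have h0 := (hβfeas i θi).1
    exact ⟨div_nonneg h0 (h0.trans hle), div_le_one_of_le₀ hle (h0.trans hle)⟩
  have hdmeas : ∀ i, Measurable (Function.uncurry fun (θi : Θ i) (θ : ∀ j, Θ j) =>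
      β i θi / ∑ j, β j (Function.update θ i θi j)) := fun i =>
    ((hβmeas i).comp measurable_fst).div <| Finset.measurable_fun_sum _ fun j _ =>
      (hβmeas j).comp ((measurable_pi_apply j).comp (hupd i))
  have hxm : ∀ i, Measurable (Function.uncurry fun (θi : Θ i) (θ : ∀ j, Θ j) =>
      x (Function.update θ i θi) i) := fun i => (hxmeas i).comp (hupd i)
  have hintd := fun i => integrable_min_integral_comp (ν := F i) (μ := Measure.pi F) (hVmeas i)
    (hmono i) (hnonneg i) (hVint i) (hcmeas i) (hcnonneg i) (hdmeas i) (hd01 i)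
  have hintx := fun i => integrable_min_integral_comp (ν := F i) (μ := Measure.pi F) (hVmeas i)
    (hmono i) (hnonneg i) (hVint i) (hcmeas i) (hcnonneg i) (hxm i) (fun _ _ => hx01 _ i)
  set P : ℝ := ∑ i, ∫ θi, β i θi ∂(F i) with hPdef
  have hPi : ∀ i, 0 ≤ ∫ θi, β i θi ∂(F i) := fun i => integral_nonneg fun θi => (hβfeas i θi).1
  have hP0 : 0 ≤ P := Finset.sum_nonneg fun i _ => hPi i
  have hB : ∀ i, ∫ θ, ∑ j ∈ Finset.univ.erase i, β j (θ j) ∂(Measure.pi F) ≤ P := by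
    intro i
    rw [integral_finsetSum _ fun j _ => integrable_comp_eval (hβint j)]
    simp only [integral_comp_eval (hβmeas _).aestronglyMeasurable]
    exact Finset.sum_le_sum_of_subset_of_nonneg (Finset.erase_subset _ _) fun j _ _ => hPi j
  set z : ∀ i, Θ i → ℝ := fun i θi => ∫ θ, x (Function.update θ i θi) i ∂(Measure.pi F)
  have hz01 : ∀ i θi, z i θi ∈ Set.Icc (0 : ℝ) 1 := fun i θi =>
    ⟨integral_nonneg fun θ => hxnonneg _ i, by
      have hxi : Integrable (fun θ => x (Function.update θ i θi) i) (Measure.pi F) :=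
        integrable_of_mem_Icc ((hxm i).comp measurable_prodMk_left).aestronglyMeasurable
          fun θ => hx01 _ i
      simpa using integral_mono hxi (integrable_const (1 : ℝ)) fun θ => (hx01 _ i).2⟩
  have hzint : ∀ i, Integrable (z i) (F i) := fun i =>
    integrable_of_mem_Icc
      ((hxm i).stronglyMeasurable.integral_prod_right (ν := Measure.pi F)).aestronglyMeasurable
      (hz01 i)
  have hxint : ∀ i, Integrable (fun θ => x θ i) (Measure.pi F) := fun i =>
    integrable_of_mem_Icc (hxmeas i).aestronglyMeasurable fun θ => hx01 θ i
  have hzsum : ∑ i, ∫ θi, z i θi ∂(F i) ≤ 1 := by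
    have hz : ∀ i, ∫ θi, z i θi ∂(F i) = ∫ θ, x θ i ∂(Measure.pi F) := by
      intro i
      have hmp := measurePreserving_update_pi F i
      rw [← hmp.map_eq, integral_map hmp.measurable.aemeasurable
        (hxmeas i).aestronglyMeasurable,
        integral_prod (fun p : Θ i × (∀ j, Θ j) => x (Function.update p.2 i p.1) i)
          (hmp.integrable_comp_of_integrable (hxint i))]
    simp only [hz]
    rw [← integral_finsetSum _ fun i _ => hxint i]
    simpa using integral_mono (integrable_finsetSum _ fun i _ => hxint i)
      (integrable_const (1 : ℝ)) hxsum
  have hbidder : ∀ ε > 0, ∀ i, 3 / 8 * (∫ θi, min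
        (∫ θ, V i θi (x (Function.update θ i θi) i) ∂(Measure.pi F)) (c i θi) ∂(F i))
        + 5 / 8 * (∫ θi, β i θi ∂(F i)) - 3 / 5 * (P + ε) * (∫ θi, z i θi ∂(F i)) ≤
      ∫ θi, min (∫ θ, V i θi (β i θi / ∑ j, β j (Function.update θ i θi j)) ∂(Measure.pi F))
        (c i θi) ∂(F i) := by
    intro ε hε i
    rw [← integral_const_mul, ← integral_const_mul, ← integral_const_mul,
      ← integral_add ((hintx i).const_mul _) ((hβint i).const_mul _),
      ← integral_sub (by exact ((hintx i).const_mul _).add ((hβint i).const_mul _))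
        ((hzint i).const_mul _)]
    refine integral_mono_ae ((((hintx i).const_mul _).add ((hβint i).const_mul _)).sub
        ((hzint i).const_mul _)) (hintd i) ?_
    filter_upwards [heq i] with θi hθi
    have hVm : Measurable (V i θi) := (hVmeas i).comp measurable_prodMk_left
    have hβ := hβfeas i θi
    have hself := hθi 0 ⟨le_rfl, hcnonneg i θi⟩
    have hV0 := hnonneg i θi 0 (by simp)
    simp only [zero_div, integral_const, probReal_univ, smul_eq_mul, one_mul, sub_zero] at hself
    have hjensen := (hconc i θi).integral_comp_le_of_monotoneOn (μ := Measure.pi F) hVm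
      (hmono i θi) ((hxm i).comp measurable_prodMk_left) (fun θ => hx01 (Function.update θ i θi) i)
    simp only [Function.comp_apply, Function.uncurry_apply_pair] at hjensen
    have hdev := (hconc i θi).le_integral_proportional_share (μ := Measure.pi F) hVm
      (hmono i θi) (hnonneg i θi) (B := fun θ => ∑ j ∈ Finset.univ.erase i, β j (θ j))
      (Finset.measurable_fun_sum _ fun j _ => (hβmeas j).comp (measurable_pi_apply j))
      (integrable_finsetSum _ fun j _ => integrable_comp_eval (hβint j))
      (fun θ => Finset.sum_nonneg fun j _ => (hβfeas j _).1)
      (P := P + ε) (by linarith) ((hB i).trans (by linarith)) (hz01 i θi)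
    have hy0 : 0 ≤ 3 / 5 * z i θi * (P + ε) := by
      have := (hz01 i θi).1
      positivity
    have hdevV := fun h => hθi (3 / 5 * z i θi * (P + ε)) ⟨hy0, h⟩
    change _ ≤ V i θi (z i θi) at hjensen
    have hw1 := min_le_left (∫ θ, V i θi (x (Function.update θ i θi) i) ∂(Measure.pi F)) (c i θi)
    have hw2 := min_le_right (∫ θ, V i θi (x (Function.update θ i θi) i) ∂(Measure.pi F)) (c i θi)
    rw [show 3 / 5 * (P + ε) * z i θi = 3 / 5 * z i θi * (P + ε) by ring]
    refine le_min ?_ (by linarith [hβ.2])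
    rcases le_or_gt (3 / 5 * z i θi * (P + ε)) (c i θi) with h | h
    · linarith [hdevV h, hβ.1]
    · linarith [hβ.1, hcnonneg i θi]
  set W := ∑ i, ∫ θi, min
    (∫ θ, V i θi (β i θi / ∑ j, β j (Function.update θ i θi j)) ∂(Measure.pi F))
    (c i θi) ∂(F i) with hW
  set O := ∑ i, ∫ θi, min (∫ θ, V i θi (x (Function.update θ i θi) i) ∂(Measure.pi F))
    (c i θi) ∂(F i) with hO
  have hO0 : 0 ≤ O := Finset.sum_nonneg fun i _ => integral_nonneg fun θi =>
    le_min (integral_nonneg fun θ => hnonneg i θi _ (hx01 _ i)) (hcnonneg i θi)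
  have hmain : 3 / 8 * O ≤ W := by
    refine le_of_forall_pos_le_add fun ε hε => ?_
    have h := Finset.sum_le_sum fun i (_ : i ∈ Finset.univ) => hbidder ε hε i
    rw [Finset.sum_sub_distrib, Finset.sum_add_distrib, ← Finset.mul_sum, ← Finset.mul_sum,
      ← Finset.mul_sum, ← hPdef, ← hW, ← hO] at h
    nlinarith [mul_le_mul_of_nonneg_left hzsum (show 0 ≤ P + ε by positivity)]
  have h17 : (4 : ℝ) ≤ Real.sqrt 17 := Real.le_sqrt_of_sq_le (by norm_num)
  nlinarith [mul_nonneg (sub_nonneg.2 h17) hO0]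
end

section
/- Consider n budget-constrained bidders where bidder i has a concave, non-decreasing, non-negative valuation v_i : [0,1] → ℝ and budget c_i ≥ 0. Let b be a (possibly correlated) random bid vector with 0 ≤ b_i ≤ c_i almost surely, let B_{−i} = Σ_{j≠i} b_j and d_i = b_i/Σ_j b_j (fractions with zero denominator equal 0), and suppose that for every i and every y ∈ [0, c_i], E[v_i(d_i) − b_i] ≥ E[v_i(y/(y+B_{−i}))] − y (coarse-correlated equilibrium among budget-feasible deviations). Then for every allocation (x_1,…,x_n) with x_i ≥ 0 and Σ_i x_i ≤ 1, the expected social welfare satisfies E[Σ_i v_i(d_i)] ≥ (1/2)·Σ_i min{v_i(x_i), c_i}; that is, the social welfare at equilibrium is at least half of the optimal effective welfare. -/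
open MeasureTheory

lemma integrable_div_add_of_pos {α : Type*} [MeasurableSpace α] (μ : Measure α)
    [IsFiniteMeasure μ] {f g : α → ℝ} (hf : Measurable f) (hg : Measurable g)
    (hf0 : ∀ a, 0 < f a) (hg0 : ∀ a, 0 < g a) : Integrable (fun a => f a / (f a + g a)) μ := by
  refine Integrable.of_bound (hf.div (hf.add hg)).aestronglyMeasurable 1 (.of_forall fun a => ?_)
  have ha := hf0 a
  have hb := hg0 a
  rw [Real.norm_of_nonneg (by positivity), div_le_one (by positivity)]
  linarith

/-- For two independent copies of a positive random variable, the expected share of the first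
is one half. -/
lemma integral_integral_div_add_eq_half {Ω : Type*} [MeasurableSpace Ω] (P : Measure Ω)
    [IsProbabilityMeasure P] {m : Ω → ℝ} (hm : Measurable m) (hpos : ∀ ω, 0 < m ω) :
    (∫ a, ∫ b, m a / (m a + m b) ∂P ∂P) = 1 / 2 := by
  have hvint : Integrable (fun p : Ω × Ω => m p.1 / (m p.1 + m p.2)) (P.prod P) :=
    integrable_div_add_of_pos _ (hm.comp measurable_fst) (hm.comp measurable_snd)
      (fun _ => hpos _) fun _ => hpos _
  have hswap : (∫ a, ∫ b, m a / (m a + m b) ∂P ∂P) = ∫ b, ∫ a, m a / (m a + m b) ∂P ∂P :=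
    integral_integral_swap (f := fun a b => m a / (m a + m b)) hvint
  have hcompl : ∀ b, (∫ a, m a / (m a + m b) ∂P) = 1 - ∫ a, m b / (m b + m a) ∂P := fun b => by
    have hb : Integrable (fun a => m b / (m b + m a)) P :=
      integrable_div_add_of_pos P measurable_const hm (fun _ => hpos b) hpos
    have hsub := integral_sub (integrable_const (1 : ℝ)) hb
    rw [integral_const, probReal_univ, one_smul] at hsub
    rw [← hsub]
    refine integral_congr_ae (.of_forall fun a => ?_)
    have ha := hpos a
    have hb := hpos b
    have : m a + m b ≠ 0 := by positivity
    have : m b + m a ≠ 0 := by positivity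
    simp only
    field_simp
    ring
  simp_rw [hcompl] at hswap
  rw [integral_sub (integrable_const _) hvint.integral_prod_left, integral_const, probReal_univ,
    one_smul] at hswap
  linarith

/-- A concave non-decreasing valuation of the share won by a bid `y` against `B`, bounded below
through a threshold price `x * B + ε` truncated at `W`. -/
lemma mul_div_sub_le_valuation {v : ℝ → ℝ} (hconc : ConcaveOn ℝ (Set.Icc 0 1) v)
    (hmono : MonotoneOn v (Set.Icc 0 1)) (hnonneg : ∀ t ∈ Set.Icc (0 : ℝ) 1, 0 ≤ v t)
    {x W y B ε : ℝ} (hx : 0 < x) (hx1 : x ≤ 1) (hW : 0 < W) (hWv : W ≤ v x)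
    (hy : 0 < y) (hB : 0 ≤ B) (hε : 0 < ε) :
    W * (y / (y + min (x * B + ε) W)) - (x * B + ε - min (x * B + ε) W) ≤ v (y / (y + B)) := by
  have hxB : 0 ≤ x * B := by positivity
  have hshare : W * (y / (y + (x * B + ε))) ≤ v (y / (y + B)) := by
    have hz0 : 0 ≤ y / (y + B) := by positivity
    have hz1 : y / (y + B) ≤ 1 := by
      rw [div_le_one (by positivity)]
      linarith
    rcases le_total x (y / (y + B)) with h | h
    · have hle : y / (y + (x * B + ε)) ≤ 1 := by
        rw [div_le_one (by positivity)]
        linarith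
      calc W * (y / (y + (x * B + ε))) ≤ W * 1 := by gcongr
        _ ≤ v x := by linarith
        _ ≤ v (y / (y + B)) := hmono ⟨hx.le, hx1⟩ ⟨hz0, hz1⟩ h
    · have ht0 : 0 ≤ y / (y + B) / x := by positivity
      have ht1 : y / (y + B) / x ≤ 1 := by rwa [div_le_one hx]
      have hcc := hconc.2 (⟨hx.le, hx1⟩ : x ∈ Set.Icc (0 : ℝ) 1)
        (⟨le_rfl, zero_le_one⟩ : (0 : ℝ) ∈ Set.Icc (0 : ℝ) 1) ht0 (sub_nonneg.2 ht1) (by ring)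
      simp only [smul_eq_mul, mul_zero, add_zero, div_mul_cancel₀ _ hx.ne'] at hcc
      have h0 := mul_nonneg (sub_nonneg.2 ht1) (hnonneg 0 ⟨le_rfl, zero_le_one⟩)
      have hle : y / (y + (x * B + ε)) ≤ y / (y + B) / x := by
        rw [div_div]
        gcongr
        nlinarith
      calc W * (y / (y + (x * B + ε))) ≤ v x * (y / (y + B) / x) :=
          mul_le_mul hWv hle (by positivity) (hW.le.trans hWv)
        _ ≤ v (y / (y + B)) := by linarith
  refine le_trans ?_ hshare
  set β := x * B + ε with hβ
  have hβ0 : 0 < β := by positivity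
  rcases le_total β W with h | h
  · simp [min_eq_left h]
  · rw [min_eq_right h]
    have hdiff : W * (y / (y + W)) - W * (y / (y + β))
        = (W * y) / ((y + W) * (y + β)) * (β - W) := by
      field_simp
      ring
    have hfac : (W * y) / ((y + W) * (y + β)) ≤ 1 := by
      rw [div_le_one (by positivity)]
      nlinarith [mul_pos hy hβ0, mul_pos hW hβ0, mul_pos hy hy]
    nlinarith [mul_le_mul_of_nonneg_right hfac (sub_nonneg.2 h)]

/-- A utility that no budget-feasible deterministic bid improves is at least half the effective
value of any share `x`, minus the price `x * E[B]` of that share. -/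
lemma half_min_sub_le_utility {Ω : Type*} [MeasurableSpace Ω] (P : Measure Ω)
    [IsProbabilityMeasure P] {v : ℝ → ℝ} (hconc : ConcaveOn ℝ (Set.Icc 0 1) v)
    (hmono : MonotoneOn v (Set.Icc 0 1)) (hnonneg : ∀ t ∈ Set.Icc (0 : ℝ) 1, 0 ≤ v t)
    {c x u : ℝ} (hc : 0 ≤ c) (hx : 0 ≤ x) (hx1 : x ≤ 1)
    {B : Ω → ℝ} (hBmeas : Measurable B) (hBint : Integrable B P) (hB : ∀ᵐ ω ∂P, 0 ≤ B ω)
    (hvint : ∀ y, Integrable (fun ω => v (y / (y + B ω))) P)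
    (hu : ∀ y ∈ Set.Icc 0 c, (∫ ω, v (y / (y + B ω)) ∂P) - y ≤ u) :
    1 / 2 * min (v x) c - x * ∫ ω, B ω ∂P ≤ u := by
  have hv0 : 0 ≤ v 0 := hnonneg 0 ⟨le_rfl, zero_le_one⟩
  have hEB : 0 ≤ ∫ ω, B ω ∂P := integral_nonneg_of_ae hB
  have hu0 : v 0 ≤ u := by simpa using hu 0 ⟨le_rfl, hc⟩
  rcases hx.eq_or_lt with rfl | hx
  · linarith [min_le_left (v 0) c]
  have hW0 : 0 ≤ min (v x) c := le_min (hnonneg x ⟨hx.le, hx1⟩) hc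
  have hWv : min (v x) c ≤ v x := min_le_left _ _
  have hWc : min (v x) c ≤ c := min_le_right _ _
  generalize min (v x) c = W at hW0 hWv hWc ⊢
  rcases hW0.eq_or_lt with rfl | hW
  · have := mul_nonneg hx.le hEB
    linarith
  refine le_of_forall_pos_le_add fun ε hε => ?_
  let m : Ω → ℝ := fun ω => min (x * max (B ω) 0 + ε) W
  have hmmeas : Measurable m := by fun_prop
  have hmpos : ∀ ω, 0 < m ω := fun ω => lt_min (by positivity) hW
  have hmW : ∀ ω, m ω ≤ W := fun ω => min_le_right _ _
  have hmint : Integrable m P := Integrable.of_bound hmmeas.aestronglyMeasurable W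
    (.of_forall fun ω => by rw [Real.norm_of_nonneg (hmpos ω).le]; exact hmW ω)
  have hshare : Integrable (fun p : Ω × Ω => m p.1 / (m p.1 + m p.2)) (P.prod P) :=
    integrable_div_add_of_pos _ (hmmeas.comp measurable_fst) (hmmeas.comp measurable_snd)
      (fun _ => hmpos _) fun _ => hmpos _
  have hdev : ∀ a, W * (∫ b, m a / (m a + m b) ∂P)
      - (x * (∫ ω, B ω ∂P) + ε - ∫ ω, m ω ∂P) - m a ≤ u := fun a => by
    refine le_trans ?_ (hu (m a) ⟨(hmpos a).le, (hmW a).trans hWc⟩)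
    have ha : Integrable (fun b => m a / (m a + m b)) P :=
      integrable_div_add_of_pos P measurable_const hmmeas (fun _ => hmpos a) hmpos
    have hxB : Integrable (fun ω => x * B ω + ε) P :=
      (hBint.const_mul x).add (integrable_const ε)
    have hlow : (∫ ω, (W * (m a / (m a + m ω)) - (x * B ω + ε - m ω)) ∂P)
        ≤ ∫ ω, v (m a / (m a + B ω)) ∂P := by
      refine integral_mono_ae ((ha.const_mul W).sub (hxB.sub hmint)) (hvint _) ?_
      filter_upwards [hB] with ω hω
      have := mul_div_sub_le_valuation hconc hmono hnonneg hx hx1 hW hWv (hmpos a) hω hε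
      simpa only [m, max_eq_left hω] using this
    have hsub := integral_sub (ha.const_mul W) (hxB.sub hmint)
    simp only [Pi.sub_apply] at hsub
    rw [hsub, integral_sub hxB hmint, integral_add (hBint.const_mul x) (integrable_const ε), integral_const_mul,
      integral_const_mul, integral_const, probReal_univ, one_smul] at hlow
    linarith
  have hshareW := hshare.integral_prod_left.const_mul W
  have hshareC := hshareW.sub
    (integrable_const (x * (∫ ω, B ω ∂P) + ε - ∫ ω, m ω ∂P))
  have havg := integral_mono (hshareC.sub hmint) (integrable_const u) hdev
  rw [integral_sub' hshareC hmint, integral_sub' hshareW (integrable_const _),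
    integral_const_mul, integral_integral_div_add_eq_half P hmmeas hmpos] at havg
  simp only [integral_const, probReal_univ, one_smul] at havg
  linarith

/-- With budget-constrained bidders, at any coarse-correlated equilibrium (with deviations
restricted to budgets) the expected *social* welfare is at least half the *effective* welfare
of any feasible allocation. -/
theorem stmt_8
    {Ω : Type*} [MeasurableSpace Ω] (P : Measure Ω) [IsProbabilityMeasure P]
    (n : ℕ) (v : Fin n → ℝ → ℝ) (c : Fin n → ℝ)
    (hconc : ∀ i, ConcaveOn ℝ (Set.Icc 0 1) (v i))
    (hmono : ∀ i, MonotoneOn (v i) (Set.Icc 0 1))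
    (hnonneg : ∀ i, ∀ t ∈ Set.Icc (0:ℝ) 1, 0 ≤ v i t)
    (hc : ∀ i, 0 ≤ c i)
    (b : Fin n → Ω → ℝ)
    (hbmeas : ∀ i, Measurable (b i))
    (hbint : ∀ i, Integrable (b i) P)
    (hb : ∀ i, ∀ᵐ ω ∂P, 0 ≤ b i ω ∧ b i ω ≤ c i)
    (hdint : ∀ i, Integrable (fun ω => v i (b i ω / ∑ j, b j ω)) P)
    (hdevint : ∀ i (y : ℝ),
      Integrable (fun ω => v i (y / (y + ∑ j ∈ Finset.univ.erase i, b j ω))) P)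
    -- coarse-correlated equilibrium among budget-feasible deviations
    (heq : ∀ i, ∀ y ∈ Set.Icc 0 (c i),
      (∫ ω, (v i (b i ω / ∑ j, b j ω) - b i ω) ∂P) ≥
        (∫ ω, v i (y / (y + ∑ j ∈ Finset.univ.erase i, b j ω)) ∂P) - y)
    (x : Fin n → ℝ) (hx : ∀ i, 0 ≤ x i) (hxsum : ∑ i, x i ≤ 1) :
    (∫ ω, ∑ i, v i (b i ω / ∑ j, b j ω) ∂P) ≥
      (1 / 2) * ∑ i, min (v i (x i)) (c i) := by
  have hxle : ∀ i, x i ≤ 1 := fun i =>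
    (Finset.single_le_sum (fun j _ => hx j) (Finset.mem_univ i)).trans hxsum
  have hball : ∀ᵐ ω ∂P, ∀ i, 0 ≤ b i ω := ae_all_iff.2 fun i => (hb i).mono fun _ h => h.1
  have hEb : ∀ i, 0 ≤ ∫ ω, b i ω ∂P := fun i =>
    integral_nonneg_of_ae (hball.mono fun _ h => h i)
  have hbidder : ∀ i, 1 / 2 * min (v i (x i)) (c i) - x i * ∑ j, ∫ ω, b j ω ∂P ≤
      (∫ ω, v i (b i ω / ∑ j, b j ω) ∂P) - ∫ ω, b i ω ∂P := fun i => by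
    have h := half_min_sub_le_utility P (hconc i) (hmono i) (hnonneg i) (hc i) (hx i) (hxle i)
      (B := fun ω => ∑ j ∈ Finset.univ.erase i, b j ω)
      (Finset.measurable_fun_sum _ fun j _ => hbmeas j)
      (integrable_finsetSum _ fun j _ => hbint j)
      (hball.mono fun ω h => Finset.sum_nonneg fun j _ => h j) (hdevint i) (heq i)
    rw [integral_finsetSum _ fun j _ => hbint j, integral_sub (hdint i) (hbint i)] at h
    have hle : ∑ j ∈ Finset.univ.erase i, ∫ ω, b j ω ∂P ≤ ∑ j, ∫ ω, b j ω ∂P :=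
      Finset.sum_le_sum_of_subset_of_nonneg (Finset.erase_subset _ _) fun j _ _ => hEb j
    have := mul_le_mul_of_nonneg_left hle (hx i)
    linarith
  have hsum := Finset.sum_le_sum fun i (_ : i ∈ Finset.univ) => hbidder i
  rw [Finset.sum_sub_distrib, Finset.sum_sub_distrib, ← Finset.mul_sum, ← Finset.sum_mul] at hsum
  have hprice := mul_le_of_le_one_left
    (Finset.sum_nonneg fun j (_ : j ∈ Finset.univ) => hEb j) hxsum
  rw [integral_finsetSum _ fun i _ => hdint i]
  linarith
end

section
/- For every ε > 0 there exists a two-bidder proportional allocation game with budget-constrained bidders, a pure Nash equilibrium b of that game (where each bidder bids at most her budget and no bidder can improve her utility by deviating to any bid within her budget), and an allocation x with x_1, x_2 ≥ 0 and x_1 + x_2 ≤ 1, such that the effective welfare of the equilibrium satisfies min{v_1(d_1), c_1} + min{v_2(d_2), c_2} ≤ (1/2 + ε)·(min{v_1(x_1), c_1} + min{v_2(x_2), c_2}), where d_i = b_i/(b_1+b_2). In particular, the price of anarchy over pure Nash equilibria with respect to the effective welfare benchmark is at most 1/2 + ε. -/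
/-- A linear function is concave on the unit interval. -/
theorem concaveOn_const_mul_id {a : ℝ} :
    ConcaveOn ℝ (Set.Icc 0 1) fun t : ℝ => a * t :=
  (LinearMap.mulLeft ℝ a).concaveOn (convex_Icc 0 1)

/-- **Upper bound on the effective-welfare price of anarchy.** For every `ε > 0` there is a
two-bidder proportional allocation game with budget-constrained bidders, a pure Nash
equilibrium `b` of that game, and a feasible allocation `x`, such that the effective welfare of
the equilibrium is at most `(1/2 + ε)` times the effective welfare of `x`. -/
theorem stmt_9 :
    ∀ ε : ℝ, 0 < ε →
      ∃ (v : Fin 2 → ℝ → ℝ) (c b x : Fin 2 → ℝ),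
        (∀ i, ConcaveOn ℝ (Set.Icc 0 1) (v i)) ∧
        (∀ i, MonotoneOn (v i) (Set.Icc 0 1)) ∧
        (∀ i, ∀ t ∈ Set.Icc (0:ℝ) 1, 0 ≤ v i t) ∧
        (∀ i, 0 < c i) ∧
        -- each bidder bids within her budget
        (∀ i, 0 ≤ b i ∧ b i ≤ c i) ∧
        -- pure Nash equilibrium: no bidder gains by deviating within her budget
        (∀ i, ∀ y ∈ Set.Icc 0 (c i),
          v i (b i / (b 0 + b 1)) - b i ≥
            v i (y / (y + ∑ j ∈ Finset.univ.erase i, b j)) - y) ∧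
        -- feasible allocation x
        (0 ≤ x 0) ∧ (0 ≤ x 1) ∧ (x 0 + x 1 ≤ 1) ∧
        -- equilibrium effective welfare ≤ (1/2 + ε) · effective welfare of x
        (min (v 0 (b 0 / (b 0 + b 1))) (c 0) + min (v 1 (b 1 / (b 0 + b 1))) (c 1) ≤
          (1 / 2 + ε) * (min (v 0 (x 0)) (c 0) + min (v 1 (x 1)) (c 1))) := by
  intro ε hε
  obtain ⟨β, hβ, hβ1, hβε⟩ : ∃ β : ℝ, 0 < β ∧ β ≤ 1 ∧ β ≤ ε :=
    ⟨min ε 1, lt_min hε one_pos, min_le_right _ _, min_le_left _ _⟩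
  have hK : 0 < (1 + β) ^ 2 / β := by positivity
  have hL : 0 < (1 + β) ^ 2 := by positivity
  refine ⟨![fun t => (1 + β) ^ 2 / β * t, fun t => (1 + β) ^ 2 * t], ![1, (1 + β) ^ 2],
    ![1, β], ![β / (1 + β) ^ 2, 1 - β / (1 + β) ^ 2], ?_, ?_, ?_, ?_, ?_, ?_, ?_, ?_, ?_, ?_⟩
  · exact Fin.forall_fin_two.2 ⟨concaveOn_const_mul_id, concaveOn_const_mul_id⟩
  · exact Fin.forall_fin_two.2 ⟨fun s _ t _ h => mul_le_mul_of_nonneg_left h hK.le,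
      fun s _ t _ h => mul_le_mul_of_nonneg_left h hL.le⟩
  · exact Fin.forall_fin_two.2 ⟨fun t ht => mul_nonneg hK.le ht.1,
      fun t ht => mul_nonneg hL.le ht.1⟩
  · exact Fin.forall_fin_two.2 ⟨one_pos, hL⟩
  · refine Fin.forall_fin_two.2 ⟨⟨zero_le_one, le_rfl⟩, hβ.le, ?_⟩
    change β ≤ (1 + β) ^ 2
    nlinarith
  · have h0 : ∑ j ∈ Finset.univ.erase (0 : Fin 2), ![1, β] j = β := by
      rw [show Finset.univ.erase (0 : Fin 2) = {1} by decide]; simp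
    have h1 : ∑ j ∈ Finset.univ.erase (1 : Fin 2), ![1, β] j = 1 := by
      rw [show Finset.univ.erase (1 : Fin 2) = {0} by decide]; simp
    refine Fin.forall_fin_two.2 ⟨fun y hy => ?_, fun y hy => ?_⟩
    · rw [h0]
      obtain ⟨hy0, hy1⟩ : 0 ≤ y ∧ y ≤ 1 := hy
      change (1 + β) ^ 2 / β * (y / (y + β)) - y ≤ (1 + β) ^ 2 / β * (1 / (1 + β)) - 1
      have hyβ : 0 < y + β := by positivity
      have key : (1 + β) ^ 2 / β * (1 / (1 + β)) - 1 - ((1 + β) ^ 2 / β * (y / (y + β)) - y)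
          = (1 - y) ^ 2 / (y + β) := by
        field_simp
        ring
      have : 0 ≤ (1 - y) ^ 2 / (y + β) := by positivity
      linarith
    · rw [h1]
      have hy0 : 0 ≤ y := hy.1
      change (1 + β) ^ 2 * (y / (y + 1)) - y ≤ (1 + β) ^ 2 * (β / (1 + β)) - β
      have key : (1 + β) ^ 2 * (β / (1 + β)) - β - ((1 + β) ^ 2 * (y / (y + 1)) - y)
          = (y - β) ^ 2 / (y + 1) := by
        field_simp
        ring
      have : 0 ≤ (y - β) ^ 2 / (y + 1) := by positivity
      linarith
  · change 0 ≤ β / (1 + β) ^ 2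
    positivity
  · change 0 ≤ 1 - β / (1 + β) ^ 2
    rw [sub_nonneg, div_le_one hL]
    nlinarith
  · change β / (1 + β) ^ 2 + (1 - β / (1 + β) ^ 2) ≤ 1
    linarith
  · change min ((1 + β) ^ 2 / β * (1 / (1 + β))) 1 + min ((1 + β) ^ 2 * (β / (1 + β)))
        ((1 + β) ^ 2) ≤ (1 / 2 + ε) * (min ((1 + β) ^ 2 / β * (β / (1 + β) ^ 2)) 1 +
          min ((1 + β) ^ 2 * (1 - β / (1 + β) ^ 2)) ((1 + β) ^ 2))
    have e1 : (1 + β) ^ 2 * (β / (1 + β)) = β + β ^ 2 := by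
      field_simp
    have e2 : (1 + β) ^ 2 / β * (β / (1 + β) ^ 2) = 1 := by
      field_simp
    have e3 : (1 + β) ^ 2 * (1 - β / (1 + β) ^ 2) = 1 + β + β ^ 2 := by
      field_simp
      ring
    rw [e1, e2, e3, min_self, min_eq_left (show 1 + β + β ^ 2 ≤ (1 + β) ^ 2 by nlinarith)]
    calc _ ≤ 1 + (β + β ^ 2) := add_le_add (min_le_right _ _) (min_le_left _ _)
      _ ≤ (1 / 2 + β) * (1 + (1 + β + β ^ 2)) := by nlinarith [pow_pos hβ 3]
      _ ≤ (1 / 2 + ε) * (1 + (1 + β + β ^ 2)) := by gcongr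
end

section
/- Let α ∈ (0,1) and consider the two-bidder proportional allocation game in which bidder 1 has valuation v_1(t) = t and budget c_1 = α/(1+α)², and bidder 2 has valuation v_2(t) = α·t and no budget constraint. Then the bid vector b with b_1 = α/(1+α)² and b_2 = α²/(1+α)² is a pure Nash equilibrium: b_1 ≤ c_1, for every y ∈ [0, c_1] it holds that v_1(b_1/(b_1+b_2)) − b_1 ≥ v_1(y/(y+b_2)) − y, and for every y ≥ 0 it holds that v_2(b_2/(b_1+b_2)) − b_2 ≥ v_2(y/(b_1+y)) − y. -/
/-- Against a total opposing bid `z`, a bidder with linear valuation of slope `V` best responds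
with any bid `b` satisfying the first-order condition `V * z = (b + z) ^ 2`. -/
lemma proportional_allocation_best_response {V z b y : ℝ} (hz : 0 < z) (hb : 0 ≤ b)
    (hy : 0 ≤ y) (h : V * z = (b + z) ^ 2) :
    V * (y / (y + z)) - y ≤ V * (b / (b + z)) - b := by
  have hbz : 0 < b + z := by positivity
  have hyz : 0 < y + z := by positivity
  have hdiff : V * (b / (b + z)) - b - (V * (y / (y + z)) - y) = (b - y) ^ 2 / (y + z) := by
    have hsplit : V * (b / (b + z)) - b - (V * (y / (y + z)) - y)
        = V * z * (b - y) / ((b + z) * (y + z)) - (b - y) := by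
      field_simp
      ring
    rw [hsplit, h]
    field_simp
    ring
  have hnonneg : 0 ≤ (b - y) ^ 2 / (y + z) := by positivity
  linarith


/-- In the two-bidder game where bidder 1 has valuation `v₁(t) = t` and budget
`c₁ = α/(1+α)²`, and bidder 2 has valuation `v₂(t) = α·t` and no budget constraint, the bid
vector `b₁ = α/(1+α)²`, `b₂ = α²/(1+α)²` is a pure Nash equilibrium: `b₁ ≤ c₁`, bidder 1
cannot gain by deviating to any `y ∈ [0, c₁]`, and bidder 2 cannot gain by deviating to any
`y ≥ 0`. -/
theorem stmt_10 (α : ℝ) (hα : α ∈ Set.Ioo (0:ℝ) 1)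
    (v₁ v₂ : ℝ → ℝ) (hv₁ : v₁ = fun t => t) (hv₂ : v₂ = fun t => α * t)
    (c₁ b₁ b₂ : ℝ)
    (hc₁ : c₁ = α / (1 + α) ^ 2)
    (hb₁ : b₁ = α / (1 + α) ^ 2)
    (hb₂ : b₂ = α ^ 2 / (1 + α) ^ 2) :
    b₁ ≤ c₁ ∧
    (∀ y ∈ Set.Icc 0 c₁, v₁ (b₁ / (b₁ + b₂)) - b₁ ≥ v₁ (y / (y + b₂)) - y) ∧
    (∀ y : ℝ, 0 ≤ y → v₂ (b₂ / (b₁ + b₂)) - b₂ ≥ v₂ (y / (b₁ + y)) - y) := by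
  obtain ⟨hα0, -⟩ := hα
  have hb₁_pos : 0 < b₁ := by rw [hb₁]; positivity
  have hb₂_pos : 0 < b₂ := by rw [hb₂]; positivity
  have hsum : b₁ + b₂ = α / (1 + α) := by
    rw [hb₁, hb₂]
    field_simp
  refine ⟨by rw [hb₁, hc₁], fun y hy => ?_, fun y hy => ?_⟩
  · have hfoc : 1 * b₂ = (b₁ + b₂) ^ 2 := by rw [hsum, hb₂, div_pow, one_mul]
    simpa [hv₁] using
      proportional_allocation_best_response hb₂_pos hb₁_pos.le hy.1 hfoc
  · have hfoc : α * b₁ = (b₂ + b₁) ^ 2 := by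
      rw [add_comm b₂, hsum, hb₁, div_pow]
      ring
    simpa [hv₂, add_comm] using
      proportional_allocation_best_response hb₁_pos hb₂_pos.le hy hfoc
end

section
/- Let Γ be a nonnegative random variable on a probability space and let v : [0,1] → ℝ be a concave, non-decreasing, non-negative function. Then the function f defined by f(y) = E[v(y/(y+Γ))] (with the convention that a fraction with zero denominator equals 0) is concave on the interval (0,∞). -/
open MeasureTheory

/-- For `c ≥ 0`, the saturation curve `y ↦ y / (y + c)` is concave on `(0, ∞)`. -/
theorem concaveOn_div_add_const {c : ℝ} (hc : 0 ≤ c) :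
    ConcaveOn ℝ (Set.Ioi 0) (fun y : ℝ => y / (y + c)) := by
  refine ⟨convex_Ioi 0, ?_⟩
  intro x hx y hy a b ha hb hab
  simp only [Set.mem_Ioi, smul_eq_mul] at *
  have hz : 0 < a * x + b * y := convex_Ioi (0 : ℝ) hx hy ha hb hab
  have hxc : 0 < x + c := by linarith
  have hyc : 0 < y + c := by linarith
  have hzc : 0 < a * x + b * y + c := by linarith
  have key : (a * x + b * y) / (a * x + b * y + c) - (a * (x / (x + c)) + b * (y / (y + c)))
      = a * b * c * (x - y) ^ 2 / ((a * x + b * y + c) * (x + c) * (y + c)) := by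
    obtain rfl : b = 1 - a := by linarith
    field_simp
    ring
  have : 0 ≤ a * b * c * (x - y) ^ 2 / ((a * x + b * y + c) * (x + c) * (y + c)) := by
    positivity
  linarith

theorem div_add_mem_Icc {y c : ℝ} (hy : 0 < y) (hc : 0 ≤ c) :
    y / (y + c) ∈ Set.Icc (0 : ℝ) 1 :=
  ⟨by positivity, div_le_one_of_le₀ (by linarith) (by linarith)⟩

/-- A function that is monotone on `[0, 1]` is integrable along any measurable `[0, 1]`-valued
random variable. -/
theorem MonotoneOn.integrable_comp_of_mem_Icc {Ω : Type*} [MeasurableSpace Ω] {P : Measure Ω}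
    [IsFiniteMeasure P] {v : ℝ → ℝ} (hv : MonotoneOn v (Set.Icc 0 1)) {X : Ω → ℝ}
    (hX : Measurable X) (hmem : ∀ ω, X ω ∈ Set.Icc (0 : ℝ) 1) :
    Integrable (fun ω => v (X ω)) P := by
  have hw : Monotone (fun t : ℝ => v (Set.projIcc 0 1 zero_le_one t)) := fun s t hst =>
    hv (Subtype.coe_prop _) (Subtype.coe_prop _) (Set.monotone_projIcc _ hst)
  have heq : (fun ω => v (X ω)) = fun ω => v (Set.projIcc 0 1 zero_le_one (X ω)) := by
    funext ω
    rw [Set.projIcc_of_mem zero_le_one (hmem ω)]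
  have hmeas : Measurable (fun ω => v (X ω)) := by
    rw [heq]
    exact hw.measurable.comp hX
  refine Integrable.of_mem_Icc (v 0) (v 1) hmeas.aemeasurable (.of_forall fun ω => ?_)
  exact ⟨hv (by simp) (hmem ω) (hmem ω).1, hv (hmem ω) (by simp) (hmem ω).2⟩

/-- If `Γ` is a nonnegative random variable and `v : [0,1] → ℝ` is concave, non-decreasing and
non-negative, then `f(y) = E[v(y/(y+Γ))]` is concave on `(0, ∞)`. -/
theorem stmt_12
    {Ω : Type*} [MeasurableSpace Ω] (P : Measure Ω) [IsProbabilityMeasure P]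
    (Γ : Ω → ℝ) (hΓmeas : Measurable Γ) (hΓnonneg : ∀ ω, 0 ≤ Γ ω)
    (v : ℝ → ℝ) (hconc : ConcaveOn ℝ (Set.Icc 0 1) v)
    (hmono : MonotoneOn v (Set.Icc 0 1))
    (hnonneg : ∀ t ∈ Set.Icc (0:ℝ) 1, 0 ≤ v t) :
    ConcaveOn ℝ (Set.Ioi 0) (fun y => ∫ ω, v (y / (y + Γ ω)) ∂P) := by
  have hint : ∀ y : ℝ, 0 < y → Integrable (fun ω => v (y / (y + Γ ω))) P := fun y hy =>
    hmono.integrable_comp_of_mem_Icc (by fun_prop) fun ω => div_add_mem_Icc hy (hΓnonneg ω)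
  refine ⟨convex_Ioi 0, ?_⟩
  intro x hx y hy a b ha hb hab
  have hz : a • x + b • y ∈ Set.Ioi (0 : ℝ) := convex_Ioi (0 : ℝ) hx hy ha hb hab
  simp only [smul_eq_mul] at hz ⊢
  rw [← integral_const_mul, ← integral_const_mul,
    ← integral_add ((hint x hx).const_mul a) ((hint y hy).const_mul b)]
  refine integral_mono (((hint x hx).const_mul a).add ((hint y hy).const_mul b)) (hint _ hz)
    fun ω => ?_
  have hmx := div_add_mem_Icc hx (hΓnonneg ω)
  have hmy := div_add_mem_Icc hy (hΓnonneg ω)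
  exact (hconc.2 hmx hmy ha hb hab).trans <|
    hmono (hconc.1 hmx hmy ha hb hab) (div_add_mem_Icc hz (hΓnonneg ω))
      ((concaveOn_div_add_const (hΓnonneg ω)).2 hx hy ha hb hab)
end
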